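/- arXiv:1801.00706 — 2 statements merged into one kernel-verified Lean document; each statement's English description precedes it below -/
import Mathlib

section
/- Let α > 0 and let g = (g(j))_{j≥0} be a sequence of complex numbers such that the iterated differences satisfy g^{(m)}(j) = o(j^{−1−m} ⟨log j⟩^{−α}) as j → ∞ for all m = 0, 1, …, N(α). Then the singular values of the Hankel operator G in ℓ²(ℤ₊) with matrix elements g(j) satisfy s_n(G) = o(n^{−α}) as n → ∞. -/
noncomputable section
open MeasureTheory Filter Asymptotics Set

/-- Lebesgue measure restricted to `(0, ∞)`. -/
abbrev muP : Measure ℝ := volume.restrict (Set.Ioi (0:ℝ))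

/-- The Hilbert space `L²((0,∞))`. -/
abbrev HSp := Lp ℂ 2 muP

/-- The Hilbert space `L²(ℝ)`. -/
abbrev HLine := Lp ℂ 2 (volume : Measure ℝ)

/-- The Hilbert space `ℓ²(ℤ₊)`. -/
abbrev ellTwo := lp (fun _ : ℕ => ℂ) 2

/-- `H` is the Hankel operator with kernel `h` : `(Hu)(t) = ∫₀^∞ h(t+s) u(s) ds`. -/
def IsHankel (h : ℝ → ℂ) (H : HSp →L[ℂ] HSp) : Prop :=
  ∀ u : HSp, ∀ᵐ t ∂muP, (H u : ℝ → ℂ) t = ∫ s in Set.Ioi (0:ℝ), h (t + s) * (u : ℝ → ℂ) s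

/-- `G` is the discrete Hankel operator with matrix elements `g` :
`(Gu)(j) = ∑ₖ g(j+k) u(k)`. -/
def IsHankelD (g : ℕ → ℂ) (G : ellTwo →L[ℂ] ellTwo) : Prop :=
  ∀ u : ellTwo, ∀ j : ℕ, (G u : ℕ → ℂ) j = ∑' k : ℕ, g (j + k) * (u : ℕ → ℂ) k

/-- `λₙ⁺(K)`, the `n`-th positive eigenvalue (non-increasing, with multiplicity) of a compact
self-adjoint operator `K`, expressed through the Courant–Fischer max-min principle
(the value is `0` if `K` has fewer than `n` positive eigenvalues). -/
def posEig {E : Type*} [NormedAddCommGroup E] [InnerProductSpace ℂ E]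
    (K : E →L[ℂ] E) (n : ℕ) : ℝ :=
  ⨆ V : {V : Submodule ℂ E // Module.finrank ℂ V = n},
    ⨅ x : {x : E // x ∈ V.1 ∧ ‖x‖ = 1}, (@inner ℂ E _ (K x.1) x.1).re

/-- `λₙ⁻(K) = λₙ⁺(-K)`. -/
def negEig {E : Type*} [NormedAddCommGroup E] [InnerProductSpace ℂ E]
    (K : E →L[ℂ] E) (n : ℕ) : ℝ := posEig (-K) n

/-- `sₙ(K)`, the `n`-th singular value of a compact operator `K`, via the max–min principle. -/
def singVal {E : Type*} [NormedAddCommGroup E] [InnerProductSpace ℂ E]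
    (K : E →L[ℂ] E) (n : ℕ) : ℝ :=
  ⨆ V : {V : Submodule ℂ E // Module.finrank ℂ V = n},
    ⨅ x : {x : E // x ∈ V.1 ∧ ‖x‖ = 1}, ‖K x.1‖

/-- `N(α) = [α] + 1` if `α ≥ 1/2`, and `N(α) = 0` if `α < 1/2`. -/
def Nal (α : ℝ) : ℕ := if α < 1/2 then 0 else Nat.floor α + 1

/-- The constant `τ(α) = 2^{-α} π^{1-2α} B(1/(2α), 1/2)^α`. -/
def tauC (α : ℝ) : ℝ :=
  (2:ℝ) ^ (-α) * Real.pi ^ (1 - 2*α) *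
    (Real.Gamma (1/(2*α)) * Real.Gamma (1/2) / Real.Gamma (1/(2*α) + 1/2)) ^ α

/-- Iterated differences of a sequence: `g⁽⁰⁾ = g`, `g⁽ᵐ⁾(j) = g⁽ᵐ⁻¹⁾(j+1) - g⁽ᵐ⁻¹⁾(j)`. -/
def iterDiff {E : Type*} [Sub E] (g : ℕ → E) : ℕ → ℕ → E
  | 0 => g
  | m + 1 => fun j => iterDiff g m (j + 1) - iterDiff g m j

/-- The standard function `v(x) = √π / √(cosh πx)`. -/
def vStd (x : ℝ) : ℝ := Real.sqrt Real.pi / Real.sqrt (Real.cosh (Real.pi * x))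

/-- The Fourier transform `(Φw)(ξ) = (2π)^{-1/2} ∫ e^{-ixξ} w(x) dx`. -/
def fou (w : ℝ → ℂ) (ξ : ℝ) : ℂ :=
  (((2 * Real.pi) ^ (-(1:ℝ)/2) : ℝ) : ℂ) * ∫ x : ℝ, Complex.exp (-(Complex.I * x * ξ)) * w x

/-- `h ∈ L^∞_loc((0,∞))`. -/
def LinftyLoc {E : Type*} [NormedAddCommGroup E] (h : ℝ → E) : Prop :=
  AEStronglyMeasurable h muP ∧
    ∀ K : Set ℝ, IsCompact K → K ⊆ Set.Ioi 0 → ∃ C, ∀ᵐ t ∂muP, t ∈ K → ‖h t‖ ≤ C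

/-- The quadratic-form characterization of the pseudodifferential operator
`A = v(X) s(D) v(X)` on `L²(ℝ)`:  `⟪g, A f⟫ = ∫ conj((Φ(v·g))(ξ)) s(ξ) (Φ(v·f))(ξ) dξ`
for all `f, g` represented by smooth compactly supported functions. -/
def IsVSDV (v : ℝ → ℝ) (s : ℝ → ℂ) (A : HLine →L[ℂ] HLine) : Prop :=
  ∀ (f g : HLine) (F G : ℝ → ℂ),
    ContDiff ℝ (⊤ : ℕ∞) F → HasCompactSupport F → ContDiff ℝ (⊤ : ℕ∞) G → HasCompactSupport G →
    (f : ℝ → ℂ) =ᵐ[volume] F → (g : ℝ → ℂ) =ᵐ[volume] G →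
    (@inner ℂ HLine _ g (A f)) =
      ∫ ξ : ℝ, (starRingEnd ℂ) (fou (fun x => (v x : ℂ) * G x) ξ) * s ξ *
        fou (fun x => (v x : ℂ) * F x) ξ


/-- An upper bound for singular values: it suffices to control `∑ ‖K vₗ‖²` over orthonormal systems
annihilated by a small finite set of functionals. -/
theorem singVal_le_of_forall_orthonormal {E : Type*} [NormedAddCommGroup E]
    [InnerProductSpace ℂ E] (K : E →L[ℂ] E) (S : Finset (Module.Dual ℂ E)) {n m : ℕ} (hn : 0 < n)
    (hm : n + S.card ≤ m) {B : ℝ} (hB : 0 ≤ B)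
    (h : ∀ v : Fin n → E, Orthonormal ℂ v → (∀ l, ∀ φ ∈ S, φ (v l) = 0) →
      ∑ l, ‖K (v l)‖ ^ 2 ≤ n * B ^ 2) : singVal K m ≤ B := by
  refine Real.iSup_le ?_ hB
  rintro ⟨V, hV⟩
  have : FiniteDimensional ℂ V := Module.finite_of_finrank_pos (by omega)
  let L : V →ₗ[ℂ] (S → ℂ) := LinearMap.pi fun φ => φ.1 ∘ₗ V.subtype
  have hker : n ≤ Module.finrank ℂ (LinearMap.ker L) := by
    have h1 := LinearMap.finrank_range_add_finrank_ker L
    have h2 : Module.finrank ℂ (LinearMap.range L) ≤ S.card := by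
      simpa using Submodule.finrank_le (LinearMap.range L)
    omega
  let b := stdOrthonormalBasis ℂ (LinearMap.ker L)
  let v : Fin n → E := fun l => ((b (Fin.castLE hker l) : V) : E)
  have hv : Orthonormal ℂ v := by
    have h1 := b.orthonormal.comp (Fin.castLE hker) (Fin.castLE_injective hker)
    have h2 := h1.comp_linearIsometry (LinearMap.ker L).subtypeₗᵢ
    exact h2.comp_linearIsometry V.subtypeₗᵢ
  have hk : ∀ l, ∀ φ ∈ S, φ (v l) = 0 := by
    intro l φ hφ
    have h1 : L (b (Fin.castLE hker l)) = 0 := (b (Fin.castLE hker l)).2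
    exact congrFun h1 ⟨φ, hφ⟩
  have hsum := h v hv hk
  set c := ⨅ x : {x : E // x ∈ V ∧ ‖x‖ = 1}, ‖K x.1‖
  have hc0 : 0 ≤ c := Real.iInf_nonneg fun _ => norm_nonneg _
  have hc : ∀ l, c ≤ ‖K (v l)‖ := fun l =>
    ciInf_le ⟨0, by rintro _ ⟨x, rfl⟩; exact norm_nonneg _⟩
      (⟨v l, (b (Fin.castLE hker l) : V).2, hv.1 l⟩ : {x : E // x ∈ V ∧ ‖x‖ = 1})
  have h1 : (n : ℝ) * c ^ 2 ≤ n * B ^ 2 := by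
    calc (n : ℝ) * c ^ 2 = ∑ _l : Fin n, c ^ 2 := by simp
      _ ≤ ∑ l, ‖K (v l)‖ ^ 2 := Finset.sum_le_sum fun l _ => pow_le_pow_left₀ hc0 (hc l) 2
      _ ≤ _ := hsum
  have hn' : (0 : ℝ) < n := by exact_mod_cast hn
  exact (pow_le_pow_iff_left₀ hc0 hB two_ne_zero).1 (le_of_mul_le_mul_left h1 hn')

theorem singVal_nonneg {E : Type*} [NormedAddCommGroup E] [InnerProductSpace ℂ E]
    (K : E →L[ℂ] E) (n : ℕ) : 0 ≤ singVal K n :=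
  Real.iSup_nonneg fun _ => Real.iInf_nonneg fun _ => norm_nonneg _

/-- Remainder estimate in Newton's forward difference expansion. -/
theorem norm_iterDiff_sub_newton_le (g : ℕ → ℂ) (D : ℝ) (N : ℕ) :
    ∀ m t s : ℕ, (∀ u, t ≤ u → ‖iterDiff g (m + N) u‖ ≤ D) →
      ‖iterDiff g m (t + s) - ∑ k ∈ Finset.range N, (s.choose k : ℂ) * iterDiff g (m + k) t‖
        ≤ (s : ℝ) ^ N * D := by
  induction N with
  | zero =>
    intro m t s h
    simpa using h (t + s) (Nat.le_add_right _ _)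
  | succ N ih =>
    intro m t s h
    have hD : 0 ≤ D := (norm_nonneg _).trans (h t le_rfl)
    set R : ℕ → ℂ := fun u => iterDiff g m (t + u) -
      ∑ k ∈ Finset.range (N + 1), (u.choose k : ℂ) * iterDiff g (m + k) t with hR
    have h0 : R 0 = 0 := by
      simp [hR, Finset.sum_range_succ']
    have hstep : ∀ u, R (u + 1) - R u = iterDiff g (m + 1) (t + u) -
        ∑ k ∈ Finset.range N, (u.choose k : ℂ) * iterDiff g (m + 1 + k) t := by
      intro u
      simp only [hR, Finset.sum_range_succ']
      have h1 : ∑ k ∈ Finset.range N, ((u + 1).choose (k + 1) : ℂ) * iterDiff g (m + (k + 1)) t =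
          ∑ k ∈ Finset.range N, (u.choose k : ℂ) * iterDiff g (m + 1 + k) t +
          ∑ k ∈ Finset.range N, (u.choose (k + 1) : ℂ) * iterDiff g (m + (k + 1)) t := by
        rw [← Finset.sum_add_distrib]
        refine Finset.sum_congr rfl fun k _ => ?_
        rw [Nat.choose_succ_succ, show m + 1 + k = m + (k + 1) by ring]
        push_cast
        ring
      rw [h1]
      simp only [iterDiff, Nat.choose_zero_right, add_assoc]
      ring
    have hsum : R s = ∑ u ∈ Finset.range s, (R (u + 1) - R u) := by
      rw [Finset.sum_range_sub, h0, sub_zero]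
    change ‖R s‖ ≤ _
    rw [hsum]
    calc ‖∑ u ∈ Finset.range s, (R (u + 1) - R u)‖
        ≤ ∑ u ∈ Finset.range s, (s : ℝ) ^ N * D := by
          refine norm_sum_le_of_le _ fun u hu => ?_
          rw [hstep]
          refine (ih (m + 1) t u fun w hw => ?_).trans ?_
          · rw [show m + 1 + N = m + (N + 1) by ring]
            exact h w hw
          · have : (u : ℝ) ≤ s := by exact_mod_cast (Finset.mem_range.1 hu).le
            gcongr
      _ = _ := by rw [Finset.sum_const, Finset.card_range, nsmul_eq_mul]; ring

theorem sum_inv_sqrt_mul_inv_add_le {i : ℕ} (hi : 0 < i) (t : Finset ℕ) (ht : ∀ j ∈ t, 0 < j) :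
    ∑ j ∈ t, (√(j : ℝ))⁻¹ * ((i : ℝ) + j)⁻¹ ≤ 4 * (√(i : ℝ))⁻¹ := by
  set y := √(i : ℝ)
  have hi' : (0 : ℝ) < i := by exact_mod_cast hi
  have hy : 0 < y := Real.sqrt_pos.2 hi'
  have hy2 : y ^ 2 = i := Real.sq_sqrt hi'.le
  set f : ℕ → ℝ := fun j => √(j : ℝ) / (y * (y + √(j : ℝ)))
  have hstep : ∀ j : ℕ, (√((j + 1 : ℕ) : ℝ))⁻¹ * ((i : ℝ) + (j + 1 : ℕ))⁻¹ ≤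
      4 * (f (j + 1) - f j) := by
    intro j
    set a := √(j : ℝ) with ha
    set b := √((j + 1 : ℕ) : ℝ) with hb
    have ha0 : 0 ≤ a := Real.sqrt_nonneg _
    have ha2 : a ^ 2 = j := Real.sq_sqrt (by positivity)
    have hb0 : 0 < b := Real.sqrt_pos.2 (by positivity)
    have hb2 : b ^ 2 = (j + 1 : ℕ) := Real.sq_sqrt (by positivity)
    have hab2 : b ^ 2 = a ^ 2 + 1 := by rw [ha2, hb2]; push_cast; ring
    have hab : a ≤ b := by nlinarith
    have hf : f (j + 1) - f j = (b - a) / ((y + b) * (y + a)) := by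
      simp only [f, ← ha, ← hb]
      field_simp
      ring
    have hba : b - a = 1 / (b + a) := by
      field_simp
      nlinarith
    rw [hf, hba, ← hb2, ← hy2, ← mul_inv, div_div, mul_one_div, inv_eq_one_div,
      div_le_div_iff₀ (by positivity) (by positivity)]
    have h1 : (y + b) * (y + a) ≤ 2 * (y ^ 2 + b ^ 2) := by nlinarith [sq_nonneg (y - b)]
    have h2 : b + a ≤ 2 * b := by linarith
    have h3 := mul_le_mul h2 h1 (by positivity) (by positivity)
    nlinarith
  have hfle : ∀ j, f j ≤ y⁻¹ := by
    intro j
    have : 0 ≤ √(j : ℝ) := Real.sqrt_nonneg _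
    simp only [f]
    rw [inv_eq_one_div, div_le_div_iff₀ (by positivity) hy]
    nlinarith
  have hrange : ∀ M : ℕ, ∑ j ∈ Finset.range M,
      (√((j + 1 : ℕ) : ℝ))⁻¹ * ((i : ℝ) + (j + 1 : ℕ))⁻¹ ≤ 4 * y⁻¹ := by
    intro M
    calc _ ≤ ∑ j ∈ Finset.range M, 4 * (f (j + 1) - f j) := Finset.sum_le_sum fun j _ => hstep j
      _ = 4 * f M := by
        rw [← Finset.mul_sum, Finset.sum_range_sub]
        simp [f]
      _ ≤ _ := by linarith [hfle M]
  refine le_trans ?_ (hrange (t.sup id + 1))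
  rw [← Finset.sum_image (s := Finset.range (t.sup id + 1)) (g := fun j => j + 1)
    (f := fun j : ℕ => (√(j : ℝ))⁻¹ * ((i : ℝ) + j)⁻¹) (fun a _ b _ h => by simpa using h)]
  refine Finset.sum_le_sum_of_subset_of_nonneg (fun j hj => ?_) fun _ _ _ => by positivity
  have h1 : j ≤ t.sup id := Finset.le_sup (f := id) hj
  have h2 := ht j hj
  exact Finset.mem_image.2 ⟨j - 1, Finset.mem_range.2 (by omega), by omega⟩

/-- A finite form of Hilbert's inequality. -/
theorem sum_sq_sum_inv_add_le (s t : Finset ℕ) (hs : ∀ i ∈ s, 0 < i) (ht : ∀ j ∈ t, 0 < j)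
    (x : ℕ → ℝ) :
    ∑ i ∈ s, (∑ j ∈ t, ((i : ℝ) + j)⁻¹ * x j) ^ 2 ≤ 16 * ∑ j ∈ t, x j ^ 2 := by
  have hrow : ∀ i ∈ s, (∑ j ∈ t, ((i : ℝ) + j)⁻¹ * x j) ^ 2 ≤
      4 * (√(i : ℝ))⁻¹ * ∑ j ∈ t, √(j : ℝ) * ((i : ℝ) + j)⁻¹ * x j ^ 2 := by
    intro i hi
    refine (Finset.sum_sq_le_sum_mul_sum_of_sq_le_mul t
      (f := fun j : ℕ => (√(j : ℝ))⁻¹ * ((i : ℝ) + j)⁻¹)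
      (g := fun j : ℕ => √(j : ℝ) * ((i : ℝ) + j)⁻¹ * x j ^ 2)
      (fun j _ => by positivity) (fun j _ => by positivity) fun j hj => ?_).trans ?_
    · have : (0 : ℝ) < √(j : ℝ) := Real.sqrt_pos.2 (by exact_mod_cast ht j hj)
      apply le_of_eq
      field_simp
    · exact mul_le_mul_of_nonneg_right (sum_inv_sqrt_mul_inv_add_le (hs i hi) t ht)
        (Finset.sum_nonneg fun j _ => by positivity)
  calc _ ≤ ∑ i ∈ s, 4 * (√(i : ℝ))⁻¹ * ∑ j ∈ t, √(j : ℝ) * ((i : ℝ) + j)⁻¹ * x j ^ 2 :=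
        Finset.sum_le_sum hrow
    _ = ∑ j ∈ t, 4 * √(j : ℝ) * x j ^ 2 * ∑ i ∈ s, (√(i : ℝ))⁻¹ * ((j : ℝ) + i)⁻¹ := by
        simp_rw [Finset.mul_sum]
        rw [Finset.sum_comm]
        refine Finset.sum_congr rfl fun j _ => Finset.sum_congr rfl fun i _ => ?_
        rw [add_comm (j : ℝ) i]
        ring
    _ ≤ ∑ j ∈ t, 16 * x j ^ 2 := by
        refine Finset.sum_le_sum fun j hj => ?_
        have hj0 : (0 : ℝ) < √(j : ℝ) := Real.sqrt_pos.2 (by exact_mod_cast ht j hj)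
        calc _ ≤ 4 * √(j : ℝ) * x j ^ 2 * (4 * (√(j : ℝ))⁻¹) :=
              mul_le_mul_of_nonneg_left (sum_inv_sqrt_mul_inv_add_le (ht j hj) s hs) (by positivity)
          _ = 16 * x j ^ 2 := by field_simp; ring
    _ = _ := by rw [Finset.mul_sum]

/-- Bessel's inequality for finitely supported rows. -/
theorem sum_norm_sq_sum_mul_le {n : ℕ} {v : Fin n → ellTwo} (hv : Orthonormal ℂ v)
    (T : Finset ℕ) (e : ℕ → ℂ) :
    ∑ l, ‖∑ j ∈ T, e j * (v l : ℕ → ℂ) j‖ ^ 2 ≤ ∑ j ∈ T, ‖e j‖ ^ 2 := by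
  set x : ellTwo := ∑ j ∈ T, lp.single 2 j (starRingEnd ℂ (e j)) with hx
  have hnorm : ‖x‖ ^ 2 = ∑ j ∈ T, ‖e j‖ ^ 2 := by
    have := lp.norm_sum_single (p := 2) (E := fun _ : ℕ => ℂ) (by norm_num)
      (fun j => starRingEnd ℂ (e j)) T
    simpa using this
  rw [← hnorm]
  refine le_trans (le_of_eq ?_) (hv.sum_inner_products_le x (s := Finset.univ))
  refine Finset.sum_congr rfl fun l _ => ?_
  congr 1
  rw [hx, inner_sum, ← RCLike.norm_conj, map_sum]
  congr 1
  refine Finset.sum_congr rfl fun j _ => ?_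
  rw [lp.inner_single_right]
  simp

theorem sum_Ico_inv_sq_le {c : ℕ} (hc : 0 < c) (M : ℕ) :
    ∑ j ∈ Finset.Ico c M, ((j : ℝ) ^ 2)⁻¹ ≤ 2 * (c : ℝ)⁻¹ := by
  have hc' : (1 : ℝ) ≤ c := by exact_mod_cast hc
  rcases lt_or_ge c M with h | h
  · rw [Finset.sum_eq_sum_Ico_succ_bot h]
    have h1 : ∑ j ∈ Finset.Ico (c + 1) M, ((j : ℝ) ^ 2)⁻¹ ≤ (c : ℝ)⁻¹ := by
      have h2 := sum_Ioc_inv_sq_le_sub (α := ℝ) (k := c) (n := M - 1) hc.ne' (by omega)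
      have h3 : Finset.Ico (c + 1) M = Finset.Ioc c (M - 1) := by
        ext j; simp only [Finset.mem_Ico, Finset.mem_Ioc]; omega
      rw [h3]
      have : (0 : ℝ) ≤ ((M - 1 : ℕ) : ℝ)⁻¹ := by positivity
      linarith
    have h4 : ((c : ℝ) ^ 2)⁻¹ ≤ (c : ℝ)⁻¹ := inv_anti₀ (by positivity) (by nlinarith)
    linarith
  · rw [Finset.Ico_eq_empty (by omega)]
    simp only [Finset.sum_empty]
    positivity

theorem sum_Ico_two_pow {M : Type*} [AddCommMonoid M] (f : ℕ → M) {A n : ℕ} (h : A ≤ n) :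
    ∑ i ∈ Finset.Ico (2 ^ A) (2 ^ n), f i =
      ∑ a ∈ Finset.Ico A n, ∑ i ∈ Finset.Ico (2 ^ a) (2 ^ (a + 1)), f i := by
  induction n, h using Nat.le_induction with
  | base => simp
  | succ n hn ih =>
    rw [Finset.sum_Ico_succ_top hn, ← ih]
    exact (Finset.sum_Ico_consecutive f (Nat.pow_le_pow_right two_pos hn)
      (Nat.pow_le_pow_right two_pos (Nat.le_succ n))).symm

theorem log_eq_of_mem_Ico_two_pow {a i : ℕ} (h : i ∈ Finset.Ico (2 ^ a) (2 ^ (a + 1))) :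
    Nat.log 2 i = a := by
  rw [Finset.mem_Ico] at h
  exact Nat.log_eq_of_pow_le_of_lt_pow h.1 h.2

theorem sum_Ico_rpow_neg_le {β : ℝ} (h0 : 0 ≤ β) (h1 : β < 1) (n : ℕ) :
    ∑ a ∈ Finset.Ico 1 n, (a : ℝ) ^ (-β) ≤ (n : ℝ) ^ (1 - β) / (1 - β) := by
  set s := 1 - β with hs
  have hs0 : 0 < s := by linarith
  have hstep : ∀ a : ℕ, ((1 + a : ℕ) : ℝ) ^ (-β) ≤ (((a + 1 : ℕ) : ℝ) ^ s - (a : ℝ) ^ s) / s := by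
    intro a
    have hx : (0 : ℝ) < a + 1 := by positivity
    have h2 : (1 + -((a : ℝ) + 1)⁻¹) ^ s ≤ 1 + s * -((a : ℝ) + 1)⁻¹ :=
      rpow_one_add_le_one_add_mul_self
        (neg_le_neg (inv_le_one_of_one_le₀ (by linarith [(Nat.cast_nonneg a : (0 : ℝ) ≤ a)])))
        hs0.le (by linarith)
    have h3 : (a : ℝ) = (a + 1) * (1 + -((a : ℝ) + 1)⁻¹) := by field_simp; ring
    have h4 : (a : ℝ) ^ s = ((a : ℝ) + 1) ^ s * (1 + -((a : ℝ) + 1)⁻¹) ^ s := by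
      rw [← Real.mul_rpow hx.le, ← h3]
      have : (1 : ℝ) + -((a : ℝ) + 1)⁻¹ = a / (a + 1) := by field_simp; ring
      rw [this]; positivity
    have h5 : ((a : ℝ) + 1) ^ (-β) = ((a : ℝ) + 1) ^ s * ((a : ℝ) + 1)⁻¹ := by
      rw [← Real.rpow_neg_one, ← Real.rpow_add hx]
      congr 1
      rw [hs]
      ring
    have h6 : (0 : ℝ) ≤ ((a : ℝ) + 1) ^ s := by positivity
    push_cast
    rw [add_comm (1 : ℝ), le_div_iff₀ hs0, h5, h4]
    nlinarith [mul_le_mul_of_nonneg_left h2 h6]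
  rw [Finset.sum_Ico_eq_sum_range]
  calc _ ≤ ∑ a ∈ Finset.range (n - 1), (((a + 1 : ℕ) : ℝ) ^ s - (a : ℝ) ^ s) / s :=
        Finset.sum_le_sum fun a _ => hstep a
    _ = ((n - 1 : ℕ) : ℝ) ^ s / s := by
        rw [← Finset.sum_div, Finset.sum_range_sub (fun a : ℕ => (a : ℝ) ^ s)]
        simp [Real.zero_rpow hs0.ne']
    _ ≤ _ := by
        have : ((n - 1 : ℕ) : ℝ) ≤ n := by exact_mod_cast Nat.sub_le n 1
        gcongr

/-- Choice of the number of subintervals `r a` in the dyadic interval `[2^a, 2^(a+1))`: their total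
number is `O(n)` while the resulting squared error is `O(n^(1-2α))`. -/
theorem exists_subdivision {α : ℝ} (hα : 0 < α) {N : ℕ}
    (h : N = 0 ∧ α < 1 / 2 ∨ 0 < N ∧ α < N) :
    ∃ C : ℝ, 0 ≤ C ∧ ∀ n : ℕ, 0 < n → ∃ r : ℕ → ℕ, (∀ a, 1 ≤ r a) ∧
      ∑ a ∈ Finset.Ico 1 n, (r a : ℝ) ≤ C * n ∧
      ∑ a ∈ Finset.Ico 1 n, ((a : ℝ) ^ (-α) / (r a : ℝ) ^ N) ^ 2 ≤ C * (n : ℝ) ^ (1 - 2 * α) := by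
  rcases h with ⟨rfl, h⟩ | ⟨hN, h⟩
  · have hpos : 0 < 1 - 2 * α := by linarith
    have hC : 1 ≤ 1 / (1 - 2 * α) := by rw [le_div_iff₀ hpos]; linarith
    refine ⟨1 / (1 - 2 * α), by positivity, fun n hn => ⟨fun _ => 1, fun _ => le_rfl, ?_, ?_⟩⟩
    · have h1 : ((n - 1 : ℕ) : ℝ) ≤ n := by exact_mod_cast Nat.sub_le n 1
      have h2 : (0 : ℝ) ≤ n := by positivity
      simp only [Nat.cast_one, Finset.sum_const, Nat.card_Ico, nsmul_eq_mul, mul_one]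
      nlinarith
    · refine le_trans (le_of_eq ?_) ((sum_Ico_rpow_neg_le (β := 2 * α) (by linarith) (by linarith)
        n).trans_eq (by ring))
      refine Finset.sum_congr rfl fun a _ => ?_
      rw [pow_zero, div_one, ← Real.rpow_natCast, ← Real.rpow_mul (by positivity)]
      congr 1
      push_cast
      ring
  · have hN' : (0 : ℝ) < N := by exact_mod_cast hN
    set β := α / N with hβ
    have hβ0 : 0 ≤ β := by positivity
    have hβ1 : β < 1 := (div_lt_one hN').2 h
    have hs : 0 < 1 - β := by linarith
    refine ⟨1 + 1 / (1 - β), by positivity, fun n hn =>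
      ⟨fun a => ⌊((n : ℝ) / a) ^ β⌋₊ + 1, fun _ => Nat.le_add_left _ _, ?_, ?_⟩⟩
    all_goals have hn' : (0 : ℝ) < n := by exact_mod_cast hn
    · calc _ ≤ ∑ a ∈ Finset.Ico 1 n, (1 + (n : ℝ) ^ β * (a : ℝ) ^ (-β)) := by
            refine Finset.sum_le_sum fun a _ => ?_
            push_cast
            rw [add_comm, Real.rpow_neg (by positivity), ← div_eq_mul_inv,
              ← Real.div_rpow (by positivity) (by positivity)]
            gcongr
            exact Nat.floor_le (by positivity)
        _ ≤ n + (n : ℝ) ^ β * ((n : ℝ) ^ (1 - β) / (1 - β)) := by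
            rw [Finset.sum_add_distrib, ← Finset.mul_sum]
            refine add_le_add ?_
              (mul_le_mul_of_nonneg_left (sum_Ico_rpow_neg_le hβ0 hβ1 n) (by positivity))
            simp
        _ = _ := by
            rw [← mul_div_assoc, ← Real.rpow_add hn']
            simp
            ring
    · calc _ ≤ ∑ a ∈ Finset.Ico 1 n, ((n : ℝ) ^ (-α)) ^ 2 := by
            refine Finset.sum_le_sum fun a ha => ?_
            have ha' : (0 : ℝ) < a := by
              exact_mod_cast (Finset.mem_Ico.1 ha).1
            refine pow_le_pow_left₀ (by positivity) ?_ 2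
            rw [div_le_iff₀ (by positivity)]
            have h1 : ((n : ℝ) / a) ^ α ≤ ((⌊((n : ℝ) / a) ^ β⌋₊ + 1 : ℕ) : ℝ) ^ N := by
              have h2 : ((n : ℝ) / a) ^ α = (((n : ℝ) / a) ^ β) ^ N := by
                rw [← Real.rpow_natCast, ← Real.rpow_mul (by positivity), hβ,
                  div_mul_cancel₀ _ hN'.ne']
              rw [h2]
              refine pow_le_pow_left₀ (by positivity) ?_ N
              push_cast
              exact (Nat.lt_floor_add_one _).le
            calc (a : ℝ) ^ (-α) = (n : ℝ) ^ (-α) * ((n : ℝ) / a) ^ α := by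
                  rw [Real.div_rpow hn'.le ha'.le, Real.rpow_neg hn'.le, Real.rpow_neg ha'.le]
                  have : (n : ℝ) ^ α ≠ 0 := by positivity
                  field_simp
              _ ≤ _ := mul_le_mul_of_nonneg_left h1 (by positivity)
        _ ≤ n * ((n : ℝ) ^ (-α)) ^ 2 := by
            rw [Finset.sum_const, nsmul_eq_mul]
            refine mul_le_mul_of_nonneg_right ?_ (by positivity)
            simp
        _ = 1 * (n : ℝ) ^ (1 - 2 * α) := by
            rw [← Real.rpow_natCast, ← Real.rpow_mul hn'.le, one_mul]
            nth_rw 1 [← Real.rpow_one (n : ℝ)]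
            rw [← Real.rpow_add hn']
            congr 1
            push_cast
            ring
        _ ≤ _ := by
            refine mul_le_mul_of_nonneg_right ?_ (by positivity)
            have : 0 ≤ 1 / (1 - β) := by positivity
            linarith

/-- The left endpoint of the subinterval containing `i`, when the dyadic interval
`[2^a, 2^(a+1))` is cut into pieces of length `2^a / r a + 1`. -/
def gridPoint (r : ℕ → ℕ) (i : ℕ) : ℕ :=
  2 ^ Nat.log 2 i + (i - 2 ^ Nat.log 2 i) / (2 ^ Nat.log 2 i / r (Nat.log 2 i) + 1) *
    (2 ^ Nat.log 2 i / r (Nat.log 2 i) + 1)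

theorem two_pow_log_le_gridPoint (r : ℕ → ℕ) (i : ℕ) : 2 ^ Nat.log 2 i ≤ gridPoint r i :=
  Nat.le_add_right _ _

theorem gridPoint_le (r : ℕ → ℕ) {i : ℕ} (hi : 0 < i) : gridPoint r i ≤ i := by
  have h1 : 2 ^ Nat.log 2 i ≤ i := Nat.pow_log_le_self 2 hi.ne'
  have h2 := Nat.div_mul_le_self (i - 2 ^ Nat.log 2 i) (2 ^ Nat.log 2 i / r (Nat.log 2 i) + 1)
  unfold gridPoint
  omega

theorem sub_gridPoint_le (r : ℕ → ℕ) {i : ℕ} (hi : 0 < i) :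
    i - gridPoint r i ≤ 2 ^ Nat.log 2 i / r (Nat.log 2 i) := by
  have h1 : 2 ^ Nat.log 2 i ≤ i := Nat.pow_log_le_self 2 hi.ne'
  have h2 := Nat.div_add_mod' (i - 2 ^ Nat.log 2 i) (2 ^ Nat.log 2 i / r (Nat.log 2 i) + 1)
  have h3 : (i - 2 ^ Nat.log 2 i) % (2 ^ Nat.log 2 i / r (Nat.log 2 i) + 1) <
      2 ^ Nat.log 2 i / r (Nat.log 2 i) + 1 := Nat.mod_lt _ (Nat.succ_pos _)
  unfold gridPoint
  omega

theorem card_image_gridPoint_le {r : ℕ → ℕ} (hr : ∀ a, 1 ≤ r a) {A n : ℕ} :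
    ((Finset.Ico (2 ^ A) (2 ^ n)).image (gridPoint r)).card ≤ ∑ a ∈ Finset.Ico A n, r a := by
  have hsub : (Finset.Ico (2 ^ A) (2 ^ n)).image (gridPoint r) ⊆
      (Finset.Ico A n).biUnion fun a => (Finset.range (r a)).image fun q =>
        2 ^ a + q * (2 ^ a / r a + 1) := by
    intro x hx
    obtain ⟨i, hi, rfl⟩ := Finset.mem_image.1 hx
    rw [Finset.mem_Ico] at hi
    have hi0 : i ≠ 0 := by have := Nat.two_pow_pos A; omega
    have h1 : 2 ^ Nat.log 2 i ≤ i := Nat.pow_log_le_self 2 hi0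
    have h2 : i < 2 ^ (Nat.log 2 i + 1) := Nat.lt_pow_succ_log_self one_lt_two i
    refine Finset.mem_biUnion.2 ⟨Nat.log 2 i, Finset.mem_Ico.2
      ⟨Nat.le_log_of_pow_le one_lt_two hi.1, Nat.log_lt_of_lt_pow hi0 hi.2⟩,
      Finset.mem_image.2 ⟨_, Finset.mem_range.2 ?_, rfl⟩⟩
    rw [Nat.div_lt_iff_lt_mul (Nat.succ_pos _), Nat.succ_eq_add_one]
    have h3 : 2 ^ Nat.log 2 i < r (Nat.log 2 i) * (2 ^ Nat.log 2 i / r (Nat.log 2 i) + 1) :=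
      Nat.lt_mul_div_succ _ (hr (Nat.log 2 i))
    rw [pow_succ] at h2
    omega
  refine (Finset.card_le_card hsub).trans (Finset.card_biUnion_le.trans ?_)
  refine Finset.sum_le_sum fun a _ => ?_
  simpa using Finset.card_image_le (s := Finset.range (r a))
    (f := fun q => 2 ^ a + q * (2 ^ a / r a + 1))

/-- The error of the Newton expansion of `g (i + j)` in the variable `i` based at `p i`. -/
def newtonRem (g : ℕ → ℂ) (N : ℕ) (p : ℕ → ℕ) (i j : ℕ) : ℂ :=
  g (i + j) - ∑ k ∈ Finset.range N, ((i - p i).choose k : ℂ) * iterDiff g k (p i + j)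

/-- The error of the Newton expansion of `g (i + j)` in the variable with smaller base point. -/
def hankelErr (g : ℕ → ℂ) (N : ℕ) (p : ℕ → ℕ) (i j : ℕ) : ℂ :=
  if p i ≤ p j then newtonRem g N p i j else newtonRem g N p j i

theorem norm_newtonRem_le {g : ℕ → ℂ} {N : ℕ} {ρ : ℕ → ℝ} {A : ℕ}
    (hg : ∀ a, A ≤ a → ∀ t, 2 ^ a ≤ t → ‖iterDiff g N t‖ ≤ ρ a / (t : ℝ) ^ (N + 1))
    (hρ : ∀ a, 0 ≤ ρ a) {r : ℕ → ℕ} (hr : ∀ a, 1 ≤ r a) {i j : ℕ} (hi : 2 ^ A ≤ i)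
    (hj : 2 ^ Nat.log 2 i ≤ j) :
    ‖newtonRem g N (gridPoint r) i j‖ ≤
      ρ (Nat.log 2 i) / (r (Nat.log 2 i) : ℝ) ^ N / j := by
  set a := Nat.log 2 i with ha
  have hi0 : 0 < i := (Nat.two_pow_pos A).trans_le hi
  have hAa : A ≤ a := Nat.le_log_of_pow_le one_lt_two hi
  have hj0 : (0 : ℝ) < j := by exact_mod_cast (Nat.two_pow_pos a).trans_le hj
  have hr0 : (0 : ℝ) < r a := by exact_mod_cast hr a
  have h1 := norm_iterDiff_sub_newton_le g (ρ a / (j : ℝ) ^ (N + 1)) N 0 (gridPoint r i + j)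
    (i - gridPoint r i) (fun u hu => by
      rw [zero_add]
      refine (hg a hAa u (by omega)).trans ?_
      have : (j : ℝ) ≤ u := by exact_mod_cast (by omega : j ≤ u)
      have := hρ a
      gcongr)
  have h2 : gridPoint r i + j + (i - gridPoint r i) = i + j := by
    have := gridPoint_le r hi0
    omega
  rw [h2] at h1
  simp only [zero_add] at h1
  refine h1.trans ?_
  have h3 : ((i - gridPoint r i : ℕ) : ℝ) ≤ j / r a := by
    calc ((i - gridPoint r i : ℕ) : ℝ) ≤ ((2 ^ a / r a : ℕ) : ℝ) := by
          exact_mod_cast sub_gridPoint_le r hi0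
      _ ≤ ((2 ^ a : ℕ) : ℝ) / r a := Nat.cast_div_le
      _ ≤ _ := by
          have : ((2 ^ a : ℕ) : ℝ) ≤ j := by exact_mod_cast hj
          gcongr
  calc _ ≤ ((j : ℝ) / r a) ^ N * (ρ a / (j : ℝ) ^ (N + 1)) := by
        have := hρ a
        gcongr
    _ = _ := by
        rw [div_pow, pow_succ]
        field_simp

/-- The Hilbert–Schmidt bound for the error kernel. -/
theorem sum_norm_sq_hankelErr_le {g : ℕ → ℂ} {N : ℕ} {ρ : ℕ → ℝ} {A : ℕ}
    (hg : ∀ a, A ≤ a → ∀ t, 2 ^ a ≤ t → ‖iterDiff g N t‖ ≤ ρ a / (t : ℝ) ^ (N + 1))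
    (hρ : ∀ a, 0 ≤ ρ a) {r : ℕ → ℕ} (hr : ∀ a, 1 ≤ r a) {n : ℕ} (hAn : A ≤ n) :
    ∑ i ∈ Finset.Ico (2 ^ A) (2 ^ n), ∑ j ∈ Finset.Ico (2 ^ A) (2 ^ n),
      ‖hankelErr g N (gridPoint r) i j‖ ^ 2 ≤
      4 * ∑ a ∈ Finset.Ico A n, (ρ a / (r a : ℝ) ^ N) ^ 2 := by
  set T := Finset.Ico (2 ^ A) (2 ^ n) with hT
  set w : ℕ → ℝ := fun a => ρ a / (r a : ℝ) ^ N with hw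
  set f : ℕ → ℕ → ℝ := fun i j =>
    if 2 ^ Nat.log 2 i ≤ j then (w (Nat.log 2 i) / j) ^ 2 else 0 with hf
  have hf0 : ∀ i j, 0 ≤ f i j := by
    intro i j
    simp only [hf]
    split_ifs <;> positivity
  have hrem : ∀ i ∈ T, ∀ j, 2 ^ Nat.log 2 i ≤ j →
      ‖newtonRem g N (gridPoint r) i j‖ ^ 2 ≤ f i j := by
    intro i hi j hij
    simp only [hf, if_pos hij]
    exact pow_le_pow_left₀ (norm_nonneg _)
      (norm_newtonRem_le hg hρ hr (Finset.mem_Ico.1 hi).1 hij) 2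
  have hpos : ∀ i ∈ T, 0 < i := fun i hi =>
    (Nat.two_pow_pos A).trans_le (Finset.mem_Ico.1 hi).1
  have he : ∀ i ∈ T, ∀ j ∈ T, ‖hankelErr g N (gridPoint r) i j‖ ^ 2 ≤ f i j + f j i := by
    intro i hi j hj
    have h1 := two_pow_log_le_gridPoint r i
    have h2 := two_pow_log_le_gridPoint r j
    have h3 := gridPoint_le r (hpos i hi)
    have h4 := gridPoint_le r (hpos j hj)
    unfold hankelErr
    split_ifs with h
    · exact (hrem i hi j (by omega)).trans (le_add_of_nonneg_right (hf0 _ _))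
    · exact (hrem j hj i (by omega)).trans (le_add_of_nonneg_left (hf0 _ _))
  have hrow : ∀ i ∈ T, ∑ j ∈ T, f i j ≤
      w (Nat.log 2 i) ^ 2 * (2 * ((2 ^ Nat.log 2 i : ℕ) : ℝ)⁻¹) := by
    intro i _
    calc ∑ j ∈ T, f i j = ∑ j ∈ T with 2 ^ Nat.log 2 i ≤ j, (w (Nat.log 2 i) / j) ^ 2 := by
          rw [Finset.sum_filter]
      _ ≤ ∑ j ∈ Finset.Ico ((2 : ℕ) ^ Nat.log 2 i) (2 ^ n), (w (Nat.log 2 i) / (j : ℕ)) ^ 2 := by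
          refine Finset.sum_le_sum_of_subset_of_nonneg (fun j hj => ?_) fun _ _ _ => by positivity
          simp only [hT, Finset.mem_filter, Finset.mem_Ico] at hj ⊢
          exact ⟨hj.2, hj.1.2⟩
      _ = w (Nat.log 2 i) ^ 2 *
            ∑ j ∈ Finset.Ico ((2 : ℕ) ^ Nat.log 2 i) (2 ^ n), ((j : ℝ) ^ 2)⁻¹ := by
          rw [Finset.mul_sum]
          exact Finset.sum_congr rfl fun j _ => by rw [div_pow, div_eq_mul_inv]
      _ ≤ _ := mul_le_mul_of_nonneg_left (sum_Ico_inv_sq_le (Nat.two_pow_pos _) _) (by positivity)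
  have htotal : ∑ i ∈ T, ∑ j ∈ T, f i j ≤ 2 * ∑ a ∈ Finset.Ico A n, w a ^ 2 := by
    refine (Finset.sum_le_sum hrow).trans (le_of_eq ?_)
    rw [hT, sum_Ico_two_pow _ hAn, Finset.mul_sum]
    refine Finset.sum_congr rfl fun a _ => ?_
    rw [Finset.sum_congr rfl fun i hi => by rw [log_eq_of_mem_Ico_two_pow hi],
      Finset.sum_const, Nat.card_Ico, nsmul_eq_mul]
    have h1 : 2 ^ (a + 1) - 2 ^ a = 2 ^ a := by rw [pow_succ]; omega
    have h2 : ((2 ^ a : ℕ) : ℝ) ≠ 0 := by positivity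
    rw [h1]
    field_simp
  calc _ ≤ ∑ i ∈ T, ∑ j ∈ T, (f i j + f j i) :=
        Finset.sum_le_sum fun i hi => Finset.sum_le_sum fun j hj => he i hi j hj
    _ = ∑ i ∈ T, ∑ j ∈ T, f i j + ∑ i ∈ T, ∑ j ∈ T, f i j := by
        simp_rw [Finset.sum_add_distrib]
        congr 1
        rw [Finset.sum_comm]
    _ ≤ _ := by linarith

theorem sum_mul_eq_sum_hankelErr_mul (g : ℕ → ℂ) (N : ℕ) (p : ℕ → ℕ) (T : Finset ℕ) (v : ℕ → ℂ)
    (hφ : ∀ q ∈ T.image p, ∀ k ∈ Finset.range N,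
      ∑ j ∈ T with q ≤ p j, iterDiff g k (q + j) * v j = 0)
    (hψ : ∀ q ∈ T.image p, ∀ k ∈ Finset.range N,
      ∑ j ∈ T with p j = q, ((j - q).choose k : ℂ) * v j = 0) {i : ℕ} (hi : i ∈ T) :
    ∑ j ∈ T, g (i + j) * v j = ∑ j ∈ T, hankelErr g N p i j * v j := by
  rw [← sub_eq_zero, ← Finset.sum_sub_distrib]
  have hsplit : ∀ j ∈ T, g (i + j) * v j - hankelErr g N p i j * v j =
      (if p i ≤ p j then ∑ k ∈ Finset.range N,
        ((i - p i).choose k : ℂ) * (iterDiff g k (p i + j) * v j) else 0) +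
      (if p i ≤ p j then 0 else ∑ k ∈ Finset.range N,
        iterDiff g k (p j + i) * (((j - p j).choose k : ℂ) * v j)) := by
    intro j _
    unfold hankelErr newtonRem
    split_ifs with h
    · rw [← sub_mul, sub_sub_cancel, Finset.sum_mul, add_zero]
      exact Finset.sum_congr rfl fun k _ => by ring
    · rw [← sub_mul, add_comm j i, sub_sub_cancel, Finset.sum_mul, zero_add]
      exact Finset.sum_congr rfl fun k _ => by ring
  rw [Finset.sum_congr rfl hsplit, Finset.sum_add_distrib]
  have h1 : ∑ j ∈ T, (if p i ≤ p j then ∑ k ∈ Finset.range N,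
      ((i - p i).choose k : ℂ) * (iterDiff g k (p i + j) * v j) else 0) = 0 := by
    rw [← Finset.sum_filter, Finset.sum_comm]
    refine Finset.sum_eq_zero fun k hk => ?_
    rw [← Finset.mul_sum, hφ _ (Finset.mem_image_of_mem p hi) k hk, mul_zero]
  have h2 : ∑ j ∈ T, (if p i ≤ p j then 0 else ∑ k ∈ Finset.range N,
      iterDiff g k (p j + i) * (((j - p j).choose k : ℂ) * v j)) = 0 := by
    rw [← Finset.sum_fiberwise_of_maps_to (fun j hj => Finset.mem_image_of_mem p hj)]
    refine Finset.sum_eq_zero fun q hq => ?_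
    have h3 : ∀ j ∈ T.filter (fun j => p j = q), (if p i ≤ p j then 0 else
        ∑ k ∈ Finset.range N, iterDiff g k (p j + i) * (((j - p j).choose k : ℂ) * v j)) =
        if p i ≤ q then 0 else
          ∑ k ∈ Finset.range N, iterDiff g k (q + i) * (((j - q).choose k : ℂ) * v j) := by
      intro j hj
      rw [(Finset.mem_filter.1 hj).2]
    rw [Finset.sum_congr rfl h3]
    split_ifs
    · simp
    · rw [Finset.sum_comm]
      refine Finset.sum_eq_zero fun k hk => ?_
      rw [← Finset.mul_sum, hψ q hq k hk, mul_zero]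
  rw [h1, h2, add_zero]

theorem sum_norm_sq_le_norm_sq (v : ellTwo) (s : Finset ℕ) :
    ∑ j ∈ s, ‖(v : ℕ → ℂ) j‖ ^ 2 ≤ ‖v‖ ^ 2 := by
  simpa using lp.sum_rpow_le_norm_rpow (p := 2) (by norm_num) v s

theorem norm_sq_le_of_forall_sum_le (w : ellTwo) {B : ℝ}
    (h : ∀ s : Finset ℕ, ∑ i ∈ s, ‖(w : ℕ → ℂ) i‖ ^ 2 ≤ B) : ‖w‖ ^ 2 ≤ B := by
  have hB : 0 ≤ B := by simpa using h ∅
  have h1 : ‖w‖ ≤ √B := by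
    refine lp.norm_le_of_forall_sum_le (p := 2) (by norm_num) (Real.sqrt_nonneg B) fun s => ?_
    simpa [Real.sq_sqrt hB] using h s
  calc ‖w‖ ^ 2 ≤ √B ^ 2 := pow_le_pow_left₀ (norm_nonneg _) h1 2
    _ = B := Real.sq_sqrt hB

/-- On vectors annihilating the approximating finite rank kernel, the Hankel operator is the sum of
the error kernel on the square `T × T` and a tail controlled by Hilbert's inequality. -/
theorem norm_sq_hankel_le {g : ℕ → ℂ} {G : ellTwo →L[ℂ] ellTwo} (hG : IsHankelD g G) {v : ellTwo}
    (hsum : ∀ i, Summable fun j => g (i + j) * (v : ℕ → ℂ) j) {A n : ℕ} (hAn : A ≤ n) {δ : ℝ}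
    (hδ : ∀ t, 2 ^ n ≤ t → ‖g t‖ ≤ δ / t) (N : ℕ) (p : ℕ → ℕ)
    (hv : ∀ j < 2 ^ A, (v : ℕ → ℂ) j = 0) (hGv : ∀ i < 2 ^ A, (G v : ℕ → ℂ) i = 0)
    (hφ : ∀ q ∈ (Finset.Ico (2 ^ A) (2 ^ n)).image p, ∀ k ∈ Finset.range N,
      ∑ j ∈ Finset.Ico (2 ^ A) (2 ^ n) with q ≤ p j, iterDiff g k (q + j) * (v : ℕ → ℂ) j = 0)
    (hψ : ∀ q ∈ (Finset.Ico (2 ^ A) (2 ^ n)).image p, ∀ k ∈ Finset.range N,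
      ∑ j ∈ Finset.Ico (2 ^ A) (2 ^ n) with p j = q, ((j - q).choose k : ℂ) * (v : ℕ → ℂ) j = 0) :
    ‖G v‖ ^ 2 ≤ 2 * ∑ i ∈ Finset.Ico (2 ^ A) (2 ^ n),
      ‖∑ j ∈ Finset.Ico (2 ^ A) (2 ^ n), hankelErr g N p i j * (v : ℕ → ℂ) j‖ ^ 2 +
      32 * δ ^ 2 * ‖v‖ ^ 2 := by
  set T := Finset.Ico (2 ^ A) (2 ^ n) with hT
  have hpow : 2 ^ A ≤ 2 ^ n := Nat.pow_le_pow_right two_pos hAn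
  set e : ℕ → ℂ := fun i => if i ∈ T then ∑ j ∈ T, hankelErr g N p i j * (v : ℕ → ℂ) j else 0
    with he
  have hdiff : ∀ J, 2 ^ n ≤ J → ∀ i, 2 ^ A ≤ i →
      ‖∑ j ∈ Finset.range J, g (i + j) * (v : ℕ → ℂ) j - e i‖ ≤
        δ * ∑ j ∈ Finset.Ico (2 ^ A) J, ((i : ℝ) + j)⁻¹ * ‖(v : ℕ → ℂ) j‖ := by
    intro J hJ i hi
    have h1 : ∑ j ∈ Finset.range J, g (i + j) * (v : ℕ → ℂ) j =
        ∑ j ∈ Finset.Ico (2 ^ A) J, g (i + j) * (v : ℕ → ℂ) j := by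
      rw [Finset.range_eq_Ico, ← Finset.sum_Ico_consecutive _ (Nat.zero_le _) (hpow.trans hJ),
        Finset.sum_eq_zero, zero_add]
      intro j hj
      rw [hv j (Finset.mem_Ico.1 hj).2, mul_zero]
    have hterm : ∀ j, 2 ^ n ≤ i + j →
        ‖g (i + j) * (v : ℕ → ℂ) j‖ ≤ δ * (((i : ℝ) + j)⁻¹ * ‖(v : ℕ → ℂ) j‖) := by
      intro j hj
      rw [norm_mul, ← mul_assoc]
      refine mul_le_mul_of_nonneg_right ((hδ _ hj).trans_eq ?_) (norm_nonneg _)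
      push_cast
      rw [div_eq_mul_inv]
    have hδ0 : 0 ≤ δ := by
      have h2 := (norm_nonneg _).trans (hδ _ le_rfl)
      have h3 : (0 : ℝ) < ((2 ^ n : ℕ) : ℝ) := by positivity
      exact ((div_nonneg_iff.1 h2).resolve_right fun h => absurd h.2 (not_le.2 h3)).1
    rw [h1, Finset.mul_sum]
    by_cases hiT : i ∈ T
    · have h2 : ∑ j ∈ Finset.Ico (2 ^ A) J, g (i + j) * (v : ℕ → ℂ) j - e i =
          ∑ j ∈ Finset.Ico (2 ^ n) J, g (i + j) * (v : ℕ → ℂ) j := by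
        simp only [he, if_pos hiT]
        rw [← sum_mul_eq_sum_hankelErr_mul g N p T _ hφ hψ hiT,
          ← Finset.sum_Ico_consecutive _ hpow hJ, add_sub_cancel_left]
      rw [h2]
      refine (norm_sum_le_of_le _ fun j hj => hterm j ?_).trans ?_
      · have := (Finset.mem_Ico.1 hj).1
        omega
      · exact Finset.sum_le_sum_of_subset_of_nonneg (Finset.Ico_subset_Ico_left hpow)
          fun _ _ _ => by positivity
    · simp only [he, if_neg hiT, sub_zero]
      refine norm_sum_le_of_le _ fun j _ => hterm j ?_
      simp only [hT, Finset.mem_Ico, not_and, not_lt] at hiT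
      have := hiT hi
      omega
  have hpos : ∀ i, 2 ^ A ≤ i → 0 < i := fun i hi => (Nat.two_pow_pos A).trans_le hi
  refine norm_sq_le_of_forall_sum_le _ fun s => ?_
  have hfilter : ∑ i ∈ s, ‖(G v : ℕ → ℂ) i‖ ^ 2 =
      ∑ i ∈ s with 2 ^ A ≤ i, ‖(G v : ℕ → ℂ) i‖ ^ 2 := by
    rw [Finset.sum_filter]
    refine Finset.sum_congr rfl fun i _ => ?_
    split_ifs with h
    · rfl
    · simp [hGv i (not_le.1 h)]
  rw [hfilter]
  have hlim : Tendsto (fun J => ∑ i ∈ s with 2 ^ A ≤ i,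
      ‖∑ j ∈ Finset.range J, g (i + j) * (v : ℕ → ℂ) j‖ ^ 2) atTop
      (nhds (∑ i ∈ s with 2 ^ A ≤ i, ‖(G v : ℕ → ℂ) i‖ ^ 2)) := by
    refine tendsto_finsetSum _ fun i _ => ?_
    rw [hG v i]
    exact ((hsum i).hasSum.tendsto_sum_nat.norm).pow 2
  refine le_of_tendsto hlim (eventually_atTop.2 ⟨2 ^ n, fun J hJ => ?_⟩)
  have hrow : ∀ i ∈ s.filter (fun i => 2 ^ A ≤ i),
      ‖∑ j ∈ Finset.range J, g (i + j) * (v : ℕ → ℂ) j‖ ^ 2 ≤ 2 * ‖e i‖ ^ 2 +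
        2 * δ ^ 2 * (∑ j ∈ Finset.Ico (2 ^ A) J, ((i : ℝ) + j)⁻¹ * ‖(v : ℕ → ℂ) j‖) ^ 2 := by
    intro i hi
    have h1 := hdiff J hJ i (Finset.mem_filter.1 hi).2
    set x := ∑ j ∈ Finset.range J, g (i + j) * (v : ℕ → ℂ) j
    set y := ∑ j ∈ Finset.Ico (2 ^ A) J, ((i : ℝ) + j)⁻¹ * ‖(v : ℕ → ℂ) j‖
    have h2 : ‖x‖ ≤ ‖e i‖ + δ * y := by
      have h3 := norm_le_insert' x (e i)
      linarith
    calc ‖x‖ ^ 2 ≤ (‖e i‖ + δ * y) ^ 2 := pow_le_pow_left₀ (norm_nonneg _) h2 2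
      _ ≤ _ := by nlinarith [sq_nonneg (‖e i‖ - δ * y)]
  have he2 : ∑ i ∈ s with 2 ^ A ≤ i, ‖e i‖ ^ 2 ≤
      ∑ i ∈ T, ‖∑ j ∈ T, hankelErr g N p i j * (v : ℕ → ℂ) j‖ ^ 2 := by
    calc ∑ i ∈ s with 2 ^ A ≤ i, ‖e i‖ ^ 2
        = ∑ i ∈ s with 2 ^ A ≤ i, if i ∈ T then
            ‖∑ j ∈ T, hankelErr g N p i j * (v : ℕ → ℂ) j‖ ^ 2 else 0 := by
          refine Finset.sum_congr rfl fun i _ => ?_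
          simp only [he]
          split_ifs <;> simp
      _ ≤ _ := by
          rw [← Finset.sum_filter]
          refine Finset.sum_le_sum_of_subset_of_nonneg (fun i hi => (Finset.mem_filter.1 hi).2)
            fun _ _ _ => by positivity
  calc _ ≤ ∑ i ∈ s with 2 ^ A ≤ i, (2 * ‖e i‖ ^ 2 +
        2 * δ ^ 2 * (∑ j ∈ Finset.Ico (2 ^ A) J, ((i : ℝ) + j)⁻¹ * ‖(v : ℕ → ℂ) j‖) ^ 2) :=
        Finset.sum_le_sum hrow
    _ = 2 * ∑ i ∈ s with 2 ^ A ≤ i, ‖e i‖ ^ 2 + 2 * δ ^ 2 * ∑ i ∈ s with 2 ^ A ≤ i,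
        (∑ j ∈ Finset.Ico (2 ^ A) J, ((i : ℝ) + j)⁻¹ * ‖(v : ℕ → ℂ) j‖) ^ 2 := by
        rw [Finset.sum_add_distrib, Finset.mul_sum, Finset.mul_sum]
    _ ≤ 2 * ∑ i ∈ T, ‖∑ j ∈ T, hankelErr g N p i j * (v : ℕ → ℂ) j‖ ^ 2 +
        2 * δ ^ 2 * (16 * ‖v‖ ^ 2) := by
        gcongr
        refine (sum_sq_sum_inv_add_le _ _ (fun i hi => hpos i (Finset.mem_filter.1 hi).2)
          (fun j hj => hpos j (Finset.mem_Ico.1 hj).1) fun j => ‖(v : ℕ → ℂ) j‖).trans ?_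
        exact mul_le_mul_of_nonneg_left (sum_norm_sq_le_norm_sq v _) (by norm_num)
    _ = _ := by ring

/-- The `j`-th coordinate functional on `ℓ²`. -/
def coordFunctional (j : ℕ) : Module.Dual ℂ ellTwo where
  toFun v := (v : ℕ → ℂ) j
  map_add' _ _ := rfl
  map_smul' _ _ := rfl

theorem coordFunctional_apply (j : ℕ) (v : ellTwo) : coordFunctional j v = (v : ℕ → ℂ) j := rfl

theorem singVal_hankel_le {α : ℝ} {g : ℕ → ℂ} {G : ellTwo →L[ℂ] ellTwo} (hG : IsHankelD g G)
    (hsum : ∀ (v : ellTwo) (i : ℕ), Summable fun j => g (i + j) * (v : ℕ → ℂ) j)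
    {N A n m : ℕ} {η C : ℝ} (hη : 0 ≤ η) (hC : 0 ≤ C) (hA : 0 < A) (hAn : A ≤ n)
    (hg0 : ∀ a, A ≤ a → ∀ t, 2 ^ a ≤ t → ‖g t‖ ≤ η * (a : ℝ) ^ (-α) / t)
    (hgN : ∀ a, A ≤ a → ∀ t, 2 ^ a ≤ t →
      ‖iterDiff g N t‖ ≤ η * (a : ℝ) ^ (-α) / (t : ℝ) ^ (N + 1))
    {r : ℕ → ℕ} (hr : ∀ a, 1 ≤ r a)
    (hr2 : ∑ a ∈ Finset.Ico 1 n, ((a : ℝ) ^ (-α) / (r a : ℝ) ^ N) ^ 2 ≤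
      C * (n : ℝ) ^ (1 - 2 * α))
    (hm : n + (2 * 2 ^ A + 2 * N * ∑ a ∈ Finset.Ico 1 n, r a) ≤ m) :
    singVal G m ≤ η * √(8 * C + 32) * (n : ℝ) ^ (-α) := by
  classical
  have hn : 0 < n := hA.trans_le hAn
  have hn' : (0 : ℝ) < n := by exact_mod_cast hn
  set p := gridPoint r
  set T := Finset.Ico (2 ^ A) (2 ^ n) with hT
  set P := T.image p ×ˢ Finset.range N with hP
  set φ : ℕ × ℕ → Module.Dual ℂ ellTwo := fun x =>
    ∑ j ∈ T with x.1 ≤ p j, iterDiff g x.2 (x.1 + j) • coordFunctional j with hφ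
  set ψ : ℕ × ℕ → Module.Dual ℂ ellTwo := fun x =>
    ∑ j ∈ T with p j = x.1, ((j - x.1).choose x.2 : ℂ) • coordFunctional j with hψ
  set S : Finset (Module.Dual ℂ ellTwo) :=
    ((Finset.range (2 ^ A)).image coordFunctional ∪
      (Finset.range (2 ^ A)).image fun i => coordFunctional i ∘ₗ (G : ellTwo →ₗ[ℂ] ellTwo)) ∪
    (P.image φ ∪ P.image ψ) with hS
  have hPcard : P.card ≤ N * ∑ a ∈ Finset.Ico 1 n, r a := by
    rw [hP, Finset.card_product, Finset.card_range, mul_comm]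
    refine Nat.mul_le_mul_left N ((card_image_gridPoint_le hr).trans ?_)
    exact Finset.sum_le_sum_of_subset (Finset.Ico_subset_Ico_left hA)
  have hScard : S.card ≤ 2 * 2 ^ A + 2 * N * ∑ a ∈ Finset.Ico 1 n, r a := by
    have h1 := Finset.card_image_le (s := Finset.range (2 ^ A)) (f := coordFunctional)
    have h2 := Finset.card_image_le (s := Finset.range (2 ^ A))
      (f := fun i => coordFunctional i ∘ₗ (G : ellTwo →ₗ[ℂ] ellTwo))
    have h3 := Finset.card_image_le (s := P) (f := φ)
    have h4 := Finset.card_image_le (s := P) (f := ψ)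
    rw [Finset.card_range] at h1 h2
    refine (Finset.card_union_le _ _).trans ?_
    refine (add_le_add ((Finset.card_union_le _ _).trans (add_le_add h1 h2))
      ((Finset.card_union_le _ _).trans (add_le_add (h3.trans hPcard) (h4.trans hPcard)))).trans ?_
    apply le_of_eq
    ring
  refine singVal_le_of_forall_orthonormal G S hn (by omega) (by positivity) fun v hv hk => ?_
  have hbound : ∀ l, ‖G (v l)‖ ^ 2 ≤ 2 * ∑ i ∈ T,
      ‖∑ j ∈ T, hankelErr g N p i j * (v l : ℕ → ℂ) j‖ ^ 2 +
      32 * (η * (n : ℝ) ^ (-α)) ^ 2 := by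
    intro l
    have := norm_sq_hankel_le hG (hsum (v l)) hAn (hg0 n hAn) N p
      (fun j hj => hk l (coordFunctional j) (by
        simp only [hS, Finset.mem_union]
        exact Or.inl (Or.inl (Finset.mem_image_of_mem _ (Finset.mem_range.2 hj)))))
      (fun i hi => hk l (coordFunctional i ∘ₗ (G : ellTwo →ₗ[ℂ] ellTwo)) (by
        simp only [hS, Finset.mem_union]
        exact Or.inl (Or.inr (Finset.mem_image.2 ⟨i, Finset.mem_range.2 hi, rfl⟩))))
      (fun q hq k hkN => by
        have h1 := hk l (φ (q, k)) (by
          simp only [hS, Finset.mem_union]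
          exact Or.inr (Or.inl (Finset.mem_image_of_mem _ (Finset.mk_mem_product hq hkN))))
        simpa [hφ, LinearMap.sum_apply, coordFunctional_apply] using h1)
      (fun q hq k hkN => by
        have h1 := hk l (ψ (q, k)) (by
          simp only [hS, Finset.mem_union]
          exact Or.inr (Or.inr (Finset.mem_image_of_mem _ (Finset.mk_mem_product hq hkN))))
        simpa [hψ, LinearMap.sum_apply, coordFunctional_apply] using h1)
    rwa [hv.1 l, one_pow, mul_one] at this
  have hHS := sum_norm_sq_hankelErr_le hgN (fun a => by positivity) hr hAn
  have hHS2 : 4 * ∑ a ∈ Finset.Ico A n, (η * (a : ℝ) ^ (-α) / (r a : ℝ) ^ N) ^ 2 ≤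
      4 * (η ^ 2 * (C * (n : ℝ) ^ (1 - 2 * α))) := by
    refine mul_le_mul_of_nonneg_left ?_ (by norm_num)
    refine le_trans ?_ (mul_le_mul_of_nonneg_left hr2 (sq_nonneg η))
    rw [Finset.mul_sum]
    refine le_trans (Finset.sum_le_sum_of_subset_of_nonneg (Finset.Ico_subset_Ico_left hA)
      fun _ _ _ => by positivity) (le_of_eq (Finset.sum_congr rfl fun a _ => ?_))
    rw [mul_div_assoc, mul_pow]
  have hpow : (n : ℝ) ^ (1 - 2 * α) = n * ((n : ℝ) ^ (-α)) ^ 2 := by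
    rw [← Real.rpow_natCast, ← Real.rpow_mul hn'.le]
    nth_rw 2 [← Real.rpow_one (n : ℝ)]
    rw [← Real.rpow_add hn']
    congr 1
    push_cast
    ring
  calc ∑ l, ‖G (v l)‖ ^ 2 ≤ ∑ l, (2 * ∑ i ∈ T,
        ‖∑ j ∈ T, hankelErr g N p i j * (v l : ℕ → ℂ) j‖ ^ 2 +
        32 * (η * (n : ℝ) ^ (-α)) ^ 2) := Finset.sum_le_sum fun l _ => hbound l
    _ = 2 * ∑ i ∈ T, ∑ l, ‖∑ j ∈ T, hankelErr g N p i j * (v l : ℕ → ℂ) j‖ ^ 2 +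
        n * (32 * (η * (n : ℝ) ^ (-α)) ^ 2) := by
        rw [Finset.sum_add_distrib, ← Finset.mul_sum, Finset.sum_comm]
        simp
    _ ≤ 2 * ∑ i ∈ T, ∑ j ∈ T, ‖hankelErr g N p i j‖ ^ 2 +
        n * (32 * (η * (n : ℝ) ^ (-α)) ^ 2) := by
        gcongr
        exact sum_norm_sq_sum_mul_le hv _ _
    _ ≤ 2 * (4 * (η ^ 2 * (C * (n : ℝ) ^ (1 - 2 * α)))) +
        n * (32 * (η * (n : ℝ) ^ (-α)) ^ 2) := by
        have := hHS.trans hHS2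
        gcongr
    _ = _ := by
        rw [hpow, mul_pow (η * √(8 * C + 32)), mul_pow η √(8 * C + 32),
          Real.sq_sqrt (by positivity), mul_pow]
        ring

theorem eventually_norm_iterDiff_le {α : ℝ} (hα : 0 < α) {g : ℕ → ℂ} {m : ℕ}
    (h : (fun j : ℕ => iterDiff g m j) =o[atTop]
      fun j : ℕ => (j : ℝ) ^ (-1 - (m : ℝ)) * (1 + Real.log j ^ 2) ^ (-α / 2))
    {η : ℝ} (hη : 0 < η) :
    ∀ᶠ A : ℕ in atTop, ∀ a, A ≤ a → ∀ t, 2 ^ a ≤ t →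
      ‖iterDiff g m t‖ ≤ η * (a : ℝ) ^ (-α) / (t : ℝ) ^ (m + 1) := by
  have hlog : 0 < Real.log 2 := Real.log_pos one_lt_two
  obtain ⟨t₀, ht₀⟩ := eventually_atTop.1 (h.bound (c := η * Real.log 2 ^ α) (by positivity))
  filter_upwards [eventually_ge_atTop (t₀ + 1)] with A hA a ha t ht
  have ha0 : (0 : ℝ) < a := by exact_mod_cast (by omega : 0 < a)
  have hat : a < t := Nat.lt_two_pow_self.trans_le ht
  have ht0 : (0 : ℝ) < t := by exact_mod_cast (by omega : 0 < t)
  refine (ht₀ t (by omega)).trans ?_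
  have h1 : ‖(t : ℝ) ^ (-1 - (m : ℝ)) * (1 + Real.log t ^ 2) ^ (-α / 2)‖ =
      (t : ℝ) ^ (-1 - (m : ℝ)) * (1 + Real.log t ^ 2) ^ (-α / 2) :=
    Real.norm_of_nonneg (by positivity)
  have h2 : (t : ℝ) ^ (-1 - (m : ℝ)) = ((t : ℝ) ^ (m + 1))⁻¹ := by
    rw [← Real.rpow_natCast, ← Real.rpow_neg ht0.le]
    congr 1
    push_cast
    ring
  have h3 : a * Real.log 2 ≤ Real.log t := by
    rw [← Real.log_pow]
    exact Real.log_le_log (by positivity) (by exact_mod_cast ht)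
  have h4 : (1 + Real.log t ^ 2) ^ (-α / 2) ≤ (a : ℝ) ^ (-α) * Real.log 2 ^ (-α) := by
    rw [← Real.mul_rpow ha0.le hlog.le]
    calc (1 + Real.log t ^ 2) ^ (-α / 2) ≤ ((a * Real.log 2) ^ 2) ^ (-α / 2) := by
          refine Real.rpow_le_rpow_of_nonpos (by positivity) ?_ (by linarith)
          have := pow_le_pow_left₀ (by positivity) h3 2
          linarith
      _ = _ := by
          rw [← Real.rpow_natCast, ← Real.rpow_mul (by positivity)]
          congr 1
          push_cast
          ring
  rw [h1, h2]
  calc η * Real.log 2 ^ α * (((t : ℝ) ^ (m + 1))⁻¹ * (1 + Real.log t ^ 2) ^ (-α / 2))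
      ≤ η * Real.log 2 ^ α * (((t : ℝ) ^ (m + 1))⁻¹ * ((a : ℝ) ^ (-α) * Real.log 2 ^ (-α))) := by
        gcongr
    _ = _ := by
        rw [Real.rpow_neg hlog.le]
        have : Real.log 2 ^ α ≠ 0 := by positivity
        field_simp

theorem summable_hankel_row {g : ℕ → ℂ} {D : ℝ} {t₀ : ℕ} (h : ∀ t, t₀ ≤ t → ‖g t‖ ≤ D / t)
    (v : ellTwo) (i : ℕ) : Summable fun j => g (i + j) * (v : ℕ → ℂ) j := by
  have hv : Summable fun j => ‖(v : ℕ → ℂ) j‖ ^ 2 := by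
    have := (lp.memℓp v).summable (p := 2) (by norm_num)
    simpa using this
  have hD : Summable fun j : ℕ => D ^ 2 * ((j : ℝ) ^ 2)⁻¹ :=
    (Real.summable_nat_pow_inv.2 one_lt_two).mul_left _
  refine (hD.add hv).of_norm_bounded_eventually_nat ?_
  filter_upwards [eventually_ge_atTop (t₀ + 1)] with j hj
  have hj0 : (0 : ℝ) < j := by exact_mod_cast (by omega : 0 < j)
  have hD0 : 0 ≤ D := by
    have h2 := (norm_nonneg _).trans (h j (by omega))
    exact ((div_nonneg_iff.1 h2).resolve_right fun h => absurd h.2 (not_le.2 hj0)).1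
  have h1 : ‖g (i + j)‖ ≤ D / j := by
    refine (h (i + j) (by omega)).trans ?_
    push_cast
    gcongr
    linarith [(Nat.cast_nonneg i : (0 : ℝ) ≤ i)]
  rw [norm_mul, ← inv_pow, ← mul_pow, ← div_eq_mul_inv]
  nlinarith [mul_le_mul_of_nonneg_right h1 (norm_nonneg ((v : ℕ → ℂ) j)),
    sq_nonneg (D / j - ‖(v : ℕ → ℂ) j‖), sq_nonneg (D / j), sq_nonneg ‖(v : ℕ → ℂ) j‖]

theorem Nal_spec {α : ℝ} : Nal α = 0 ∧ α < 1 / 2 ∨ 0 < Nal α ∧ α < Nal α := by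
  unfold Nal
  split_ifs with h
  · exact Or.inl ⟨rfl, h⟩
  · refine Or.inr ⟨Nat.succ_pos _, ?_⟩
    push_cast
    exact Nat.lt_floor_add_one α

/-- Theorem `thm.a1`, discrete singular value estimates.  Let `α > 0` and
let `g` be a complex sequence with iterated differences
`g^{(m)}(j) = o(j^{-1-m} ⟨log j⟩^{-α})` as `j → ∞` for all `m ≤ N(α)`.  Then the singular
values of the discrete Hankel operator `G` with matrix elements `g(j)` satisfy
`sₙ(G) = o(n^{-α})` as `n → ∞`. -/
theorem statement12 (α : ℝ) (hα : 0 < α) (g : ℕ → ℂ)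
    (hcond : ∀ m : ℕ, m ≤ Nal α →
      (fun j : ℕ => iterDiff g m j) =o[atTop]
        fun j : ℕ => (j:ℝ) ^ (-1 - (m:ℝ)) * (1 + Real.log j ^ 2) ^ (-α/2))
    (G : ellTwo →L[ℂ] ellTwo) (hG : IsHankelD g G) :
    (fun nn : ℕ => singVal G nn) =o[atTop] fun nn : ℕ => (nn:ℝ) ^ (-α) := by
  obtain ⟨C, hC, hsub⟩ := exists_subdivision hα (Nal_spec (α := α))
  set N := Nal α
  set K : ℕ := 3 + ⌈2 * N * C⌉₊ with hK
  have hK0 : (0 : ℝ) < K := by rw [hK]; positivity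
  refine IsLittleO.of_bound fun c hc => ?_
  set M : ℝ := √(8 * C + 32) * (2 * K : ℝ) ^ α with hM
  have hM0 : 0 < M := by positivity
  set η := c / M with hηdef
  have hη : 0 < η := by positivity
  obtain ⟨A, ⟨hA0, hAN⟩, hA1⟩ := ((eventually_norm_iterDiff_le hα (hcond 0 (Nat.zero_le _)) hη).and
    (eventually_norm_iterDiff_le hα (hcond N le_rfl) hη)).and (eventually_ge_atTop 1) |>.exists
  have hg0 : ∀ a, A ≤ a → ∀ t, 2 ^ a ≤ t → ‖g t‖ ≤ η * (a : ℝ) ^ (-α) / t := by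
    simpa [iterDiff] using hA0
  filter_upwards [eventually_ge_atTop (K * 2 ^ A)] with m hm
  have hKpos : 0 < K := by omega
  set n := m / K with hn
  have hAn2 : 2 ^ A ≤ n := (Nat.le_div_iff_mul_le hKpos).2 (by rwa [mul_comm])
  have hAn : A ≤ n := Nat.lt_two_pow_self.le.trans hAn2
  have hn0 : 0 < n := by omega
  have hn' : (0 : ℝ) < n := by exact_mod_cast hn0
  obtain ⟨r, hr, hr1, hr2⟩ := hsub n hn0
  have hKn : K * n ≤ m := Nat.mul_div_le m K
  have hcount : n + (2 * 2 ^ A + 2 * N * ∑ a ∈ Finset.Ico 1 n, r a) ≤ m := by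
    have h1 : 2 * N * ∑ a ∈ Finset.Ico 1 n, r a ≤ ⌈2 * N * C⌉₊ * n := by
      have h2 : (2 * N : ℝ) * ∑ a ∈ Finset.Ico 1 n, (r a : ℝ) ≤ ⌈2 * N * C⌉₊ * n :=
        calc (2 * N : ℝ) * ∑ a ∈ Finset.Ico 1 n, (r a : ℝ) ≤ 2 * N * (C * n) := by gcongr
          _ = 2 * N * C * n := by ring
          _ ≤ _ := mul_le_mul_of_nonneg_right (Nat.le_ceil _) hn'.le
      exact_mod_cast h2
    have h3 : K * n = 3 * n + ⌈2 * N * C⌉₊ * n := by rw [hK]; ring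
    omega
  have hmain := singVal_hankel_le hG (summable_hankel_row (hg0 A le_rfl)) hη.le hC hA1 hAn hg0 hAN
    hr hr2 hcount
  have hmn : (m : ℝ) / (2 * K) ≤ n := by
    rw [div_le_iff₀ (by positivity)]
    have h1 : m < K * (n + 1) := Nat.lt_mul_div_succ m hKpos
    have h2 : m ≤ n * (2 * K) := by nlinarith
    exact_mod_cast h2
  have hm0 : (0 : ℝ) < m := by
    have : 0 < m := (Nat.mul_pos hKpos hn0).trans_le hKn
    exact_mod_cast this
  have hpow : (n : ℝ) ^ (-α) ≤ (2 * K : ℝ) ^ α * (m : ℝ) ^ (-α) := by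
    refine (Real.rpow_le_rpow_of_nonpos (by positivity) hmn (by linarith)).trans_eq ?_
    rw [Real.div_rpow hm0.le (by positivity), Real.rpow_neg (by positivity : (0 : ℝ) ≤ 2 * K),
      div_inv_eq_mul, mul_comm]
  rw [Real.norm_of_nonneg (singVal_nonneg G m), Real.norm_of_nonneg (by positivity)]
  calc singVal G m ≤ η * √(8 * C + 32) * (n : ℝ) ^ (-α) := hmain
    _ ≤ η * √(8 * C + 32) * ((2 * K : ℝ) ^ α * (m : ℝ) ^ (-α)) := by gcongr
    _ = η * M * (m : ℝ) ^ (-α) := by rw [hM]; ring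
    _ = c * (m : ℝ) ^ (-α) := by rw [hηdef, div_mul_cancel₀ _ hM0.ne']
end
end

section
/- Let α > 0, κ₁, κ_{−1} ∈ ℝ, let χ₀, χ_∞ ∈ C^∞((0,∞)) be cut-offs with χ₀(t) = 1 for t ≤ 1/4, χ₀(t) = 0 for t ≥ 1/2, χ_∞(t) = 0 for t ≤ 2, χ_∞(t) = 1 for t ≥ 4, and define η_*(μ) = |log((1+μ)/(2(1−μ)))|^{−α} (κ₁ χ_∞((1+μ)/(2(1−μ))) + κ_{−1} χ₀(2(1+μ)/(1−μ))) for μ ∈ (−1,1). Then the moment sequence g_*(j) = ∫_{−1}^{1} η_*(μ) μ^j dμ has the asymptotics g_*(j) = (κ₁ + (−1)^j κ_{−1}) j^{-1} (log j)^{−α} + g̃₁(j) + (−1)^j g̃_{−1}(j), where the error sequences satisfy g̃_{±1}^{(m)}(j) = O(j^{−1−m} (log j)^{−α−1}) as j → ∞ for all m = 0, 1, 2, …. -/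
noncomputable section
open MeasureTheory Filter Asymptotics Set

theorem iterDiff_succ' (g : ℕ → ℝ) (m n : ℕ) :
    iterDiff g (m + 1) n = iterDiff (fun j => g (j + 1) - g j) m n := by
  induction m generalizing n with
  | zero => rfl
  | succ m ih =>
    change iterDiff g (m + 1) (n + 1) - iterDiff g (m + 1) n = _
    rw [ih, ih]
    rfl

theorem iterDiff_sub (f g : ℕ → ℝ) (m n : ℕ) :
    iterDiff (fun j => f j - g j) m n = iterDiff f m n - iterDiff g m n := by
  induction m generalizing n with
  | zero => rfl
  | succ m ih =>
    simp only [iterDiff, ih]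
    ring

theorem iterDiff_const_mul (c : ℝ) (g : ℕ → ℝ) (m n : ℕ) :
    iterDiff (fun j => c * g j) m n = c * iterDiff g m n := by
  induction m generalizing n with
  | zero => rfl
  | succ m ih =>
    simp only [iterDiff, ih]
    ring

/-- The mean value theorem for iterated differences. -/
theorem exists_iterDiff_eq {a : ℝ} (m : ℕ) (F : ℕ → ℝ → ℝ)
    (hF : ∀ k x, a < x → HasDerivAt (F k) (F (k + 1) x) x) (n : ℕ) (hn : a < n) :
    ∃ ξ ∈ Icc (n : ℝ) (n + m), iterDiff (fun j : ℕ => F 0 j) m n = F m ξ := by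
  induction m generalizing F with
  | zero => exact ⟨n, by simp, rfl⟩
  | succ m ih =>
    obtain ⟨ξ, hξ, h⟩ := ih (fun k x => F k (x + 1) - F k x) fun k x hx =>
      ((hF k (x + 1) (by linarith)).comp_add_const x 1).sub (hF k x hx)
    have haξ : a < ξ := hn.trans_le hξ.1
    obtain ⟨ζ, hζ, h'⟩ := exists_hasDerivAt_eq_slope (F m) (F (m + 1)) (lt_add_one ξ)
      (fun x hx => (hF m x (haξ.trans_le hx.1)).continuousAt.continuousWithinAt)
      (fun x hx => hF m x (haξ.trans hx.1))
    refine ⟨ζ, ⟨hξ.1.trans hζ.1.le, ?_⟩, ?_⟩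
    · push_cast
      linarith [hξ.2, hζ.2]
    · rw [iterDiff_succ', h', add_sub_cancel_left, div_one, ← h]
      push_cast
      rfl

open Polynomial in
/-- The `k`-th derivative of `x⁻¹ (log x)^(-α)` is
`x^(-1-k) (log x)^(-α)` times this polynomial in `(log x)⁻¹`. -/
def logDerivPoly (α : ℝ) : ℕ → ℝ[X]
  | 0 => 1
  | k + 1 => C (-1 - (k : ℝ)) * logDerivPoly α k - C α * X * logDerivPoly α k
      - X ^ 2 * derivative (logDerivPoly α k)

theorem logDerivPoly_eval_zero (α : ℝ) (k : ℕ) :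
    (logDerivPoly α k).eval 0 = (-1) ^ k * k.factorial := by
  induction k with
  | zero => simp [logDerivPoly]
  | succ k ih =>
    simp [logDerivPoly, ih, Nat.factorial_succ]
    ring

/-- The `k`-th derivative of `x⁻¹ (log x)^(-α)`. -/
def invMulLogDeriv (α : ℝ) (k : ℕ) (x : ℝ) : ℝ :=
  x ^ (-1 - (k : ℝ)) * Real.log x ^ (-α) * (logDerivPoly α k).eval (Real.log x)⁻¹

theorem hasDerivAt_invMulLogDeriv (α : ℝ) (k : ℕ) {x : ℝ} (hx : 1 < x) :
    HasDerivAt (invMulLogDeriv α k) (invMulLogDeriv α (k + 1) x) x := by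
  have h0 : 0 < x := one_pos.trans hx
  have hl : 0 < Real.log x := Real.log_pos hx
  have h1 := Real.hasDerivAt_rpow_const (x := x) (p := -1 - (k : ℝ)) (Or.inl h0.ne')
  have h2 := (Real.hasDerivAt_log h0.ne').rpow_const (p := -α) (Or.inl hl.ne')
  have h3 := ((logDerivPoly α k).hasDerivAt (Real.log x)⁻¹).comp x
    ((Real.hasDerivAt_log h0.ne').inv hl.ne')
  refine ((h1.mul h2).mul h3).congr_deriv ?_
  simp only [invMulLogDeriv, logDerivPoly, Polynomial.eval_sub, Polynomial.eval_mul,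
    Polynomial.eval_C, Polynomial.eval_X, Polynomial.eval_pow, Nat.cast_add, Nat.cast_one,
    Pi.mul_apply, Pi.inv_apply, Function.comp]
  rw [Real.rpow_sub_one hl.ne', show (-1 - ((k : ℝ) + 1)) = (-1 - k) - 1 by ring,
    Real.rpow_sub_one h0.ne']
  field_simp
  ring

theorem exists_abs_eval_le (p : Polynomial ℝ) :
    ∃ C, 0 ≤ C ∧ ∀ u ∈ Icc (0 : ℝ) 1, |p.eval u| ≤ C := by
  obtain ⟨C, hC⟩ := (isCompact_Icc (a := (0 : ℝ)) (b := 1)).exists_bound_of_continuousOn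
    p.continuous.continuousOn
  exact ⟨C, (norm_nonneg _).trans (hC 0 (by simp)), hC⟩

theorem iterDiff_inv_mul_log_rpow_isBigO {α : ℝ} (hα : 0 ≤ α) (m d : ℕ) :
    (fun j : ℕ => iterDiff (fun i : ℕ => (i : ℝ)⁻¹ * Real.log i ^ (-α)) m (j + d)
      - (-1) ^ m * m.factorial * ((j : ℝ) ^ (-1 - (m : ℝ)) * Real.log j ^ (-α)))
    =O[atTop] fun j : ℕ => (j : ℝ) ^ (-1 - (m : ℝ)) * Real.log j ^ (-α - 1) := by
  obtain ⟨C₁, hC₁, hb₁⟩ := exists_abs_eval_le (logDerivPoly α (m + 1))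
  obtain ⟨C₂, hC₂, hb₂⟩ := exists_abs_eval_le (logDerivPoly α m).divX
  refine IsBigO.of_bound ((m + d) * C₁ + C₂) ?_
  filter_upwards [eventually_ge_atTop 3] with j hj
  have hj3 : (3 : ℝ) ≤ j := by exact_mod_cast hj
  have hj0 : (0 : ℝ) < j := by linarith
  have hlog : ∀ x : ℝ, j ≤ x → 1 ≤ Real.log x := fun x hx => by
    rw [Real.le_log_iff_exp_le (by linarith)]
    linarith [Real.exp_one_lt_d9]
  have hL := hlog j le_rfl
  have hL0 : 0 < Real.log j := by linarith
  have hu : ∀ x : ℝ, j ≤ x → (Real.log x)⁻¹ ∈ Icc (0 : ℝ) 1 := fun x hx =>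
    ⟨by linarith [inv_pos.2 (one_pos.trans_le (hlog x hx))], inv_le_one_of_one_le₀ (hlog x hx)⟩
  obtain ⟨ξ, hξ, h⟩ := exists_iterDiff_eq m (invMulLogDeriv α)
    (fun k x hx => hasDerivAt_invMulLogDeriv α k hx) (j + d)
    (by push_cast; linarith [d.cast_nonneg (α := ℝ)])
  have hfun : (fun i : ℕ => (i : ℝ)⁻¹ * Real.log i ^ (-α)) = fun i : ℕ => invMulLogDeriv α 0 i := by
    ext i
    simp [invMulLogDeriv, logDerivPoly, Real.rpow_neg_one]
  push_cast at hξ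
  have hjξ : (j : ℝ) ≤ ξ := by linarith [hξ.1, d.cast_nonneg (α := ℝ)]
  have hJ : (j : ℝ) ^ (-1 - (m : ℝ)) * Real.log j ^ (-α - 1)
      = (j : ℝ) ^ (-1 - (m : ℝ)) * Real.log j ^ (-α) * (Real.log j)⁻¹ := by
    rw [Real.rpow_sub_one hL0.ne']; ring
  have hA0 : 0 ≤ (j : ℝ) ^ (-1 - (m : ℝ)) * Real.log j ^ (-α) := by positivity
  have hmain : |invMulLogDeriv α m j
      - (-1) ^ m * m.factorial * ((j : ℝ) ^ (-1 - (m : ℝ)) * Real.log j ^ (-α))|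
      ≤ C₂ * ((j : ℝ) ^ (-1 - (m : ℝ)) * Real.log j ^ (-α) * (Real.log j)⁻¹) := by
    have hQ : (logDerivPoly α m).eval (Real.log j)⁻¹
        = (logDerivPoly α m).divX.eval (Real.log j)⁻¹ * (Real.log j)⁻¹
          + (-1) ^ m * m.factorial := by
      conv_lhs => rw [← Polynomial.divX_mul_X_add (logDerivPoly α m)]
      simp [Polynomial.coeff_zero_eq_eval_zero, logDerivPoly_eval_zero]
    rw [invMulLogDeriv, hQ, show ∀ A B c k : ℝ, A * (B * c + k) - k * A = B * (A * c) from
      fun _ _ _ _ => by ring, abs_mul, abs_of_nonneg (mul_nonneg hA0 (inv_pos.2 hL0).le)]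
    exact mul_le_mul_of_nonneg_right (hb₂ _ (hu _ le_rfl)) (mul_nonneg hA0 (inv_pos.2 hL0).le)
  have hshift : |invMulLogDeriv α m ξ - invMulLogDeriv α m j|
      ≤ C₁ * ((j : ℝ) ^ (-1 - (m : ℝ)) * Real.log j ^ (-α) * (Real.log j)⁻¹) * (m + d) := by
    have hbd : ∀ x ∈ Icc (j : ℝ) ξ, ‖invMulLogDeriv α (m + 1) x‖
        ≤ C₁ * ((j : ℝ) ^ (-1 - (m : ℝ)) * Real.log j ^ (-α) * (Real.log j)⁻¹) := by
      intro x hx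
      have hx0 : 0 < x := hj0.trans_le hx.1
      have hlx := hlog x hx.1
      have e1 : x ^ (-1 - ((m + 1 : ℕ) : ℝ)) ≤ (j : ℝ) ^ (-1 - (m : ℝ)) * (Real.log j)⁻¹ := by
        calc x ^ (-1 - ((m + 1 : ℕ) : ℝ)) ≤ (j : ℝ) ^ (-1 - ((m + 1 : ℕ) : ℝ)) :=
              Real.rpow_le_rpow_of_nonpos hj0 hx.1 (by push_cast; linarith [m.cast_nonneg (α := ℝ)])
          _ = (j : ℝ) ^ (-1 - (m : ℝ)) * (j : ℝ)⁻¹ := by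
              rw [show (-1 - ((m + 1 : ℕ) : ℝ)) = (-1 - m) - 1 by push_cast; ring,
                Real.rpow_sub_one hj0.ne', div_eq_mul_inv]
          _ ≤ _ := by
              gcongr
              linarith [Real.log_le_sub_one_of_pos hj0]
      have e2 : Real.log x ^ (-α) ≤ Real.log j ^ (-α) :=
        Real.rpow_le_rpow_of_nonpos hL0 (Real.log_le_log hj0 hx.1) (by linarith)
      rw [invMulLogDeriv, Real.norm_eq_abs, abs_mul, abs_mul, abs_of_nonneg (Real.rpow_nonneg hx0.le _),
        abs_of_nonneg (Real.rpow_nonneg (by linarith) _)]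
      calc _ ≤ ((j : ℝ) ^ (-1 - (m : ℝ)) * (Real.log j)⁻¹) * Real.log j ^ (-α) * C₁ := by
            gcongr
            exact hb₁ _ (hu x hx.1)
        _ = _ := by ring
    have := (convex_Icc (j : ℝ) ξ).norm_image_sub_le_of_norm_hasDerivWithin_le
      (fun x hx => (hasDerivAt_invMulLogDeriv α m (by linarith [hx.1])).hasDerivWithinAt) hbd
      (left_mem_Icc.2 hjξ) (right_mem_Icc.2 hjξ)
    refine this.trans (mul_le_mul_of_nonneg_left ?_ (by positivity))
    rw [Real.norm_eq_abs, abs_of_nonneg (by linarith)]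
    linarith [hξ.2]
  rw [hfun, h, hJ, Real.norm_eq_abs, Real.norm_of_nonneg (by positivity)]
  calc _ ≤ _ := abs_sub_le _ (invMulLogDeriv α m j) _
    _ ≤ _ := add_le_add hshift hmain
    _ = _ := by ring

theorem iterDiff_comp_add_one (g : ℕ → ℝ) (m n : ℕ) :
    iterDiff (fun j => g (j + 1)) m n = iterDiff g m (n + 1) := by
  induction m generalizing n with
  | zero => rfl
  | succ m ih => simp only [iterDiff, ih]

theorem exists_add_abs_log_rpow_le {A p : ℝ} (hA : 0 ≤ A) (hp : 0 < p) :
    ∃ K, 0 ≤ K ∧ ∀ s : ℝ, 0 < s →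
      (A + |Real.log s|) ^ p ≤ K * (s ^ (1 / 2 : ℝ) + s ^ (-(1 / 2) : ℝ)) := by
  have key : ∀ s : ℝ, 1 ≤ s → (A + |Real.log s|) ^ p ≤ (A + 2 * p) ^ p * s ^ (1 / 2 : ℝ) := by
    intro s hs
    have hlog := Real.log_le_rpow_div (x := s) (ε := 1 / (2 * p)) (by linarith) (by positivity)
    have hone : 1 ≤ s ^ (1 / (2 * p)) := Real.one_le_rpow hs (by positivity)
    rw [abs_of_nonneg (Real.log_nonneg hs)]
    calc (A + Real.log s) ^ p ≤ ((A + 2 * p) * s ^ (1 / (2 * p))) ^ p := by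
          refine Real.rpow_le_rpow (add_nonneg hA (Real.log_nonneg hs)) ?_ hp.le
          rw [div_div_eq_mul_div, div_one] at hlog
          nlinarith
      _ = _ := by
          rw [Real.mul_rpow (by positivity) (by positivity), ← Real.rpow_mul (by linarith)]
          congr 2
          field_simp
  refine ⟨(A + 2 * p) ^ p, by positivity, fun s hs => ?_⟩
  have h₁ : 0 ≤ s ^ (1 / 2 : ℝ) := by positivity
  have h₂ : 0 ≤ s ^ (-(1 / 2) : ℝ) := by positivity
  rcases le_total 1 s with h | h
  · exact (key s h).trans (mul_le_mul_of_nonneg_left (by linarith) (by positivity))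
  · have := key s⁻¹ ((one_le_inv₀ hs).2 h)
    rw [Real.log_inv, abs_neg, Real.inv_rpow hs.le, ← Real.rpow_neg hs.le] at this
    exact this.trans (mul_le_mul_of_nonneg_left (by linarith) (by positivity))

theorem abs_rpow_neg_sub_rpow_neg_le {α a b : ℝ} (hα : 0 < α) (ha : 1 ≤ a) (hb : 1 ≤ b) :
    |a ^ (-α) - b ^ (-α)| ≤ α * b ^ (-α - 1) * (1 + |a - b|) ^ (α + 2) := by
  have hbd : ∀ x ∈ uIcc b a, ‖-α * x ^ (-α - 1)‖
      ≤ α * (b ^ (-α - 1) * (1 + |a - b|) ^ (α + 1)) := by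
    intro x hx
    have hx1 : 1 ≤ x := (le_inf hb ha).trans hx.1
    have hbx : b ≤ x * (1 + |a - b|) := by
      have : b - |a - b| ≤ x := by
        refine le_trans (le_inf (by linarith [abs_nonneg (a - b)]) ?_) hx.1
        linarith [neg_abs_le (a - b)]
      nlinarith [abs_nonneg (a - b)]
    rw [norm_mul, norm_neg, Real.norm_of_nonneg hα.le, Real.norm_of_nonneg (by positivity)]
    refine mul_le_mul_of_nonneg_left ?_ hα.le
    have hD : 0 < 1 + |a - b| := by positivity
    calc x ^ (-α - 1) ≤ (b / (1 + |a - b|)) ^ (-α - 1) :=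
          Real.rpow_le_rpow_of_nonpos (by positivity) ((div_le_iff₀ hD).2 hbx) (by linarith)
      _ = _ := by
          rw [Real.div_rpow (by linarith) hD.le, div_eq_mul_inv, ← Real.rpow_neg hD.le]
          congr 2
          ring
  have := (convex_uIcc b a).norm_image_sub_le_of_norm_hasDerivWithin_le
    (f := fun x : ℝ => x ^ (-α)) (fun x hx => (Real.hasDerivAt_rpow_const (Or.inl
      (by linarith [(le_inf hb ha).trans hx.1] : x ≠ 0))).hasDerivWithinAt) hbd
    left_mem_uIcc right_mem_uIcc
  refine this.trans ?_
  have hD : 0 < 1 + |a - b| := by positivity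
  have hpow : (1 + |a - b|) ^ (α + 2) = (1 + |a - b|) ^ (α + 1) * (1 + |a - b|) := by
    rw [← Real.rpow_add_one hD.ne']
    congr 1
    ring
  rw [hpow, Real.norm_eq_abs]
  calc _ ≤ α * (b ^ (-α - 1) * (1 + |a - b|) ^ (α + 1)) * (1 + |a - b|) := by
        gcongr
        linarith
    _ = _ := by ring

theorem exists_abs_sub_log_rpow_le {α M C x₀ : ℝ} (hα : 0 < α) (hx₀ : 0 < x₀) {u Λ : ℝ → ℝ}
    (hM : ∀ x ∈ Ioo (0 : ℝ) 1, |u x| ≤ M) (hΛ : ∀ x ∈ Ioo (0 : ℝ) x₀, 1 ≤ Λ x)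
    (hΛlog : ∀ x ∈ Ioo (0 : ℝ) x₀, |Λ x + Real.log x| ≤ C)
    (hu : ∀ x ∈ Ioo (0 : ℝ) x₀, u x = Λ x ^ (-α)) :
    ∃ K, ∀ᶠ j : ℕ in atTop, ∀ x ∈ Ioo (0 : ℝ) 1,
      |u x - Real.log j ^ (-α)| ≤ K * Real.log j ^ (-α - 1) *
        ((j * x) ^ (1 / 2 : ℝ) + (j * x) ^ (-(1 / 2) : ℝ)) := by
  have hC : 0 ≤ C := (abs_nonneg _).trans (hΛlog (x₀ / 2) ⟨by linarith, by linarith⟩)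
  have hM0 : 0 ≤ M := (abs_nonneg _).trans (hM (1 / 2) (by norm_num))
  obtain ⟨K, hK, hKs⟩ := exists_add_abs_log_rpow_le (A := 1 + C) (p := α + 2)
    (by linarith) (by linarith)
  refine ⟨α * K + (M + 1) * x₀ ^ (-(1 / 2) : ℝ), ?_⟩
  have hlo := ((isLittleO_log_rpow_rpow_atTop (α + 1) (one_half_pos (α := ℝ))).comp_tendsto
    tendsto_natCast_atTop_atTop).bound one_pos
  filter_upwards [hlo, eventually_ge_atTop 3] with j hj hj3' x hx
  have hj3 : (3 : ℝ) ≤ j := by exact_mod_cast hj3'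
  have hj0 : (0 : ℝ) < j := by linarith
  have hL : 1 ≤ Real.log j := by
    rw [Real.le_log_iff_exp_le hj0]
    linarith [Real.exp_one_lt_d9]
  have hL0 : 0 < Real.log j := by linarith
  have hx0 : 0 < x := hx.1
  have hs : 0 < j * x := mul_pos hj0 hx0
  rcases lt_or_ge x x₀ with h | h
  · have hxm : x ∈ Ioo 0 x₀ := ⟨hx.1, h⟩
    rw [hu x hxm]
    have hdist : |Λ x - Real.log j| ≤ C + |Real.log (j * x)| := by
      rw [show Λ x - Real.log j = (Λ x + Real.log x) - Real.log (j * x) by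
        rw [Real.log_mul hj0.ne' hx.1.ne']; ring]
      exact (abs_sub _ _).trans (add_le_add_left (hΛlog x hxm) _)
    calc _ ≤ α * Real.log j ^ (-α - 1) * (1 + |Λ x - Real.log j|) ^ (α + 2) :=
          abs_rpow_neg_sub_rpow_neg_le hα (hΛ x hxm) hL
      _ ≤ α * Real.log j ^ (-α - 1) * (1 + C + |Real.log (j * x)|) ^ (α + 2) := by
          gcongr ?_ * ?_ ^ _
          linarith
      _ ≤ α * Real.log j ^ (-α - 1) *
          (K * ((j * x) ^ (1 / 2 : ℝ) + (j * x) ^ (-(1 / 2) : ℝ))) := by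
          gcongr
          exact hKs _ hs
      _ ≤ _ := by
          have : 0 ≤ (M + 1) * x₀ ^ (-(1 / 2) : ℝ) * Real.log j ^ (-α - 1) *
            ((j * x) ^ (1 / 2 : ℝ) + (j * x) ^ (-(1 / 2) : ℝ)) := by positivity
          linarith
  · have h1 : |u x - Real.log j ^ (-α)| ≤ M + 1 := by
      refine (abs_sub _ _).trans (add_le_add (hM x hx) ?_)
      rw [abs_of_nonneg (by positivity)]
      exact Real.rpow_le_one_of_one_le_of_nonpos hL (by linarith)
    have h2 : 1 ≤ x₀ ^ (-(1 / 2) : ℝ) * (Real.log j ^ (-α - 1) * (j * x) ^ (1 / 2 : ℝ)) := by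
      simp only [Function.comp, Real.norm_eq_abs, one_mul] at hj
      rw [abs_of_nonneg (by positivity), abs_of_nonneg (by positivity)] at hj
      have e1 : Real.log j ^ (-α - 1) * Real.log j ^ (α + 1) = 1 := by
        rw [← Real.rpow_add hL0]
        simp
      have e2 : x₀ ^ (-(1 / 2) : ℝ) * x₀ ^ (1 / 2 : ℝ) = 1 := by
        rw [← Real.rpow_add hx₀]
        simp
      calc (1 : ℝ) = (x₀ ^ (-(1 / 2) : ℝ) * x₀ ^ (1 / 2 : ℝ)) *
            (Real.log j ^ (-α - 1) * Real.log j ^ (α + 1)) := by rw [e1, e2, one_mul]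
        _ ≤ (x₀ ^ (-(1 / 2) : ℝ) * x ^ (1 / 2 : ℝ)) *
            (Real.log j ^ (-α - 1) * (j : ℝ) ^ (1 / 2 : ℝ)) := by gcongr
        _ = _ := by rw [Real.mul_rpow hj0.le hx.1.le]; ring
    have h3 : 0 ≤ α * K * Real.log j ^ (-α - 1) *
        ((j * x) ^ (1 / 2 : ℝ) + (j * x) ^ (-(1 / 2) : ℝ)) := by positivity
    have h4 : 0 ≤ (M + 1) * x₀ ^ (-(1 / 2) : ℝ) * Real.log j ^ (-α - 1) *
        (j * x) ^ (-(1 / 2) : ℝ) := by positivity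
    have h5 := mul_le_mul_of_nonneg_left h2 (by linarith : 0 ≤ M + 1)
    linarith

theorem integrableOn_rpow_mul_exp_neg_mul {a r : ℝ} (ha : 0 < a) (hr : 0 < r) :
    IntegrableOn (fun t : ℝ => t ^ (a - 1) * Real.exp (-(r * t))) (Ioi 0) := by
  have := integrableOn_rpow_mul_exp_neg_mul_rpow (p := 1) (s := a - 1) (by linarith) one_pos hr
  simpa using this

theorem integrableOn_mul_pow_mul_one_sub_pow {u : ℝ → ℝ} (hu : IntegrableOn u (Ioo 0 1))
    (m j : ℕ) : IntegrableOn (fun x => u x * (x ^ m * (1 - x) ^ j)) (Ioo 0 1) := by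
  refine hu.mul_bdd (c := 1) (by fun_prop) ?_
  filter_upwards [ae_restrict_mem measurableSet_Ioo] with x hx
  have h₀ : 0 ≤ 1 - x := by linarith [hx.2]
  rw [Real.norm_of_nonneg (mul_nonneg (pow_nonneg hx.1.le _) (pow_nonneg h₀ _))]
  exact mul_le_one₀ (pow_le_one₀ hx.1.le hx.2.le) (pow_nonneg h₀ _)
    (pow_le_one₀ h₀ (by linarith [hx.1]))

theorem iterDiff_integral_one_sub_pow {u : ℝ → ℝ} (hu : IntegrableOn u (Ioo 0 1)) (m j : ℕ) :
    iterDiff (fun i : ℕ => ∫ x in Ioo (0 : ℝ) 1, u x * (1 - x) ^ i) m j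
      = (-1) ^ m * ∫ x in Ioo (0 : ℝ) 1, u x * (x ^ m * (1 - x) ^ j) := by
  induction m generalizing j with
  | zero => simp [iterDiff]
  | succ m ih =>
    simp only [iterDiff, ih]
    rw [← mul_sub, ← integral_sub (integrableOn_mul_pow_mul_one_sub_pow hu m _)
      (integrableOn_mul_pow_mul_one_sub_pow hu m _), pow_succ, mul_assoc, ← integral_const_mul (-1)]
    congr 2
    ext x
    ring

theorem integral_pow_mul_one_sub_pow_isBigO (α : ℝ) (m : ℕ) :
    (fun j : ℕ => Real.log j ^ (-α) * (∫ x in Ioo (0 : ℝ) 1, x ^ m * (1 - x) ^ j)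
      - m.factorial * ((j : ℝ) ^ (-1 - (m : ℝ)) * Real.log j ^ (-α)))
    =O[atTop] fun j : ℕ => (j : ℝ) ^ (-1 - (m : ℝ)) * Real.log j ^ (-α - 1) := by
  have h := (isBigO_refl (fun j : ℕ => (-1 : ℝ) ^ m * Real.log j ^ (-α)) atTop).mul
    (iterDiff_inv_mul_log_rpow_isBigO (α := 0) le_rfl m 1)
  have hint : ∀ i : ℕ, ∫ x in Ioo (0 : ℝ) 1, (1 - x) ^ i = ((i : ℝ) + 1)⁻¹ := by
    intro i
    rw [← integral_Ioc_eq_integral_Ioo, ← intervalIntegral.integral_of_le zero_le_one]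
    simp [intervalIntegral.integral_comp_sub_left (fun x : ℝ => x ^ i) 1]
  refine (h.congr_left fun j => ?_).trans (IsBigO.of_bound 1 ?_)
  · have := iterDiff_integral_one_sub_pow (u := fun _ => 1) (by simp) m j
    simp only [one_mul, hint] at this
    rw [← iterDiff_comp_add_one]
    simp only [neg_zero, Real.rpow_zero, mul_one, Nat.cast_add, Nat.cast_one, this]
    have hs : (-1 : ℝ) ^ m * (-1) ^ m = 1 := by rw [← mul_pow]; simp
    linear_combination (Real.log j ^ (-α) * (∫ x in Ioo (0 : ℝ) 1, x ^ m * (1 - x) ^ j) -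
      m.factorial * ((j : ℝ) ^ (-1 - (m : ℝ)) * Real.log j ^ (-α))) * hs
  · filter_upwards [eventually_ge_atTop 2] with j hj
    have hL : 0 < Real.log j := Real.log_pos (by exact_mod_cast hj)
    rw [Real.rpow_sub_one hL.ne', Real.rpow_sub_one hL.ne', neg_zero, Real.rpow_zero, one_mul]
    simp only [norm_mul, norm_pow, norm_neg, norm_one, one_pow, norm_div, one_mul]
    exact le_of_eq (by ring)

theorem iterDiff_moment_isBigO {α M C x₀ : ℝ} (hα : 0 < α) (hx₀ : 0 < x₀) {u Λ : ℝ → ℝ}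
    (hint : IntegrableOn u (Ioo 0 1))
    (hM : ∀ x ∈ Ioo (0 : ℝ) 1, |u x| ≤ M) (hΛ : ∀ x ∈ Ioo (0 : ℝ) x₀, 1 ≤ Λ x)
    (hΛlog : ∀ x ∈ Ioo (0 : ℝ) x₀, |Λ x + Real.log x| ≤ C)
    (hu : ∀ x ∈ Ioo (0 : ℝ) x₀, u x = Λ x ^ (-α)) (m : ℕ) :
    (fun j : ℕ => iterDiff (fun i : ℕ => (∫ x in Ioo (0 : ℝ) 1, u x * (1 - x) ^ i)
      - (i : ℝ)⁻¹ * Real.log i ^ (-α)) m j)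
    =O[atTop] fun j : ℕ => (j : ℝ) ^ (-1 - (m : ℝ)) * Real.log j ^ (-α - 1) := by
  obtain ⟨K, hK⟩ := exists_abs_sub_log_rpow_le hα hx₀ hM hΛ hΛlog hu
  have hdev : (fun j : ℕ => ∫ x in Ioo (0 : ℝ) 1,
      (u x - Real.log j ^ (-α)) * (x ^ m * (1 - x) ^ j))
      =O[atTop] fun j : ℕ => (j : ℝ) ^ (-1 - (m : ℝ)) * Real.log j ^ (-α - 1) := by
    refine IsBigO.of_bound (|K| * (Real.Gamma (m + 3 / 2) + Real.Gamma (m + 1 / 2))) ?_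
    filter_upwards [hK, eventually_ge_atTop 2] with j hKj hj
    have hj0 : (0 : ℝ) < j := by exact_mod_cast (by omega : 0 < j)
    have hL : 0 < Real.log j := Real.log_pos (by exact_mod_cast hj)
    have ha : (0 : ℝ) < m + 3 / 2 := by positivity
    have hb : (0 : ℝ) < m + 1 / 2 := by positivity
    have i₁ := integrableOn_rpow_mul_exp_neg_mul ha hj0
    have i₂ := integrableOn_rpow_mul_exp_neg_mul hb hj0
    set D : ℝ → ℝ := fun x => (|K| * Real.log j ^ (-α - 1)) *
      ((j : ℝ) ^ (1 / 2 : ℝ) * (x ^ ((m + 3 / 2 : ℝ) - 1) * Real.exp (-(j * x)))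
        + (j : ℝ) ^ (-(1 / 2) : ℝ) * (x ^ ((m + 1 / 2 : ℝ) - 1) * Real.exp (-(j * x)))) with hD
    have iD : IntegrableOn D (Ioi 0) := ((i₁.const_mul _).add (i₂.const_mul _)).const_mul _
    have hDint : ∫ x in Ioi 0, D x = |K| * (Real.Gamma (m + 3 / 2) + Real.Gamma (m + 1 / 2)) *
        ((j : ℝ) ^ (-1 - (m : ℝ)) * Real.log j ^ (-α - 1)) := by
      rw [hD, integral_const_mul, integral_add (i₁.const_mul _) (i₂.const_mul _),
        integral_const_mul, integral_const_mul, Real.integral_rpow_mul_exp_neg_mul_Ioi ha hj0,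
        Real.integral_rpow_mul_exp_neg_mul_Ioi hb hj0, one_div (j : ℝ), Real.inv_rpow hj0.le,
        Real.inv_rpow hj0.le, ← Real.rpow_neg hj0.le, ← Real.rpow_neg hj0.le, ← mul_assoc,
        ← mul_assoc, ← Real.rpow_add hj0, ← Real.rpow_add hj0,
        show (1 / 2 + -((m : ℝ) + 3 / 2)) = -1 - m by ring,
        show (-(1 / 2) + -((m : ℝ) + 1 / 2)) = -1 - m by ring]
      ring
    have hbound : ∀ᵐ x ∂(volume.restrict (Ioo (0 : ℝ) 1)),
        ‖(u x - Real.log j ^ (-α)) * (x ^ m * (1 - x) ^ j)‖ ≤ D x := by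
      filter_upwards [ae_restrict_mem measurableSet_Ioo] with x hx
      have h₀ : 0 ≤ 1 - x := by linarith [hx.2]
      have hx0 := hx.1
      have hexp : (1 - x) ^ j ≤ Real.exp (-(j * x)) := by
        rw [← mul_neg, Real.exp_nat_mul]
        exact pow_le_pow_left₀ h₀ (Real.one_sub_le_exp_neg x) j
      rw [norm_mul, Real.norm_eq_abs,
        Real.norm_of_nonneg (mul_nonneg (pow_nonneg hx0.le _) (pow_nonneg h₀ _))]
      calc _ ≤ (|K| * Real.log j ^ (-α - 1) *
            ((j * x) ^ (1 / 2 : ℝ) + (j * x) ^ (-(1 / 2) : ℝ))) *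
            (x ^ m * Real.exp (-(j * x))) := by
            gcongr
            exact (hKj x hx).trans (by gcongr; exact le_abs_self K)
        _ = D x := by
            simp only [hD]
            rw [Real.mul_rpow hj0.le hx0.le, Real.mul_rpow hj0.le hx0.le,
              show ((m : ℝ) + 3 / 2 - 1) = 1 / 2 + m by ring,
              show ((m : ℝ) + 1 / 2 - 1) = -(1 / 2) + m by ring,
              Real.rpow_add hx0, Real.rpow_add hx0, Real.rpow_natCast]
            ring
    rw [Real.norm_of_nonneg (by positivity :
      0 ≤ (j : ℝ) ^ (-1 - (m : ℝ)) * Real.log j ^ (-α - 1)), ← hDint]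
    refine (norm_integral_le_of_norm_le (iD.mono_set Ioo_subset_Ioi_self) hbound).trans ?_
    refine setIntegral_mono_set iD ?_ Ioo_subset_Ioi_self.eventuallyLE
    filter_upwards [ae_restrict_mem measurableSet_Ioi] with x hx
    have hx0 : 0 < x := hx
    simp only [hD, Pi.zero_apply]
    positivity
  have hsum := ((isBigO_refl (fun _ : ℕ => (-1 : ℝ) ^ m) atTop).mul
    (hdev.add (integral_pow_mul_one_sub_pow_isBigO α m))).trans
      (IsBigO.of_bound 1 (Eventually.of_forall fun j => by simp) :
        (fun j : ℕ => (-1 : ℝ) ^ m * ((j : ℝ) ^ (-1 - (m : ℝ)) * Real.log j ^ (-α - 1)))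
          =O[atTop] fun j : ℕ => (j : ℝ) ^ (-1 - (m : ℝ)) * Real.log j ^ (-α - 1))
  refine (hsum.sub (iterDiff_inv_mul_log_rpow_isBigO hα.le m 0)).congr_left fun j => ?_
  have i₁ := integrableOn_mul_pow_mul_one_sub_pow (u := fun _ => Real.log j ^ (-α)) (by simp) m j
  rw [iterDiff_sub, iterDiff_integral_one_sub_pow hint]
  simp only [sub_mul, add_zero]
  rw [integral_sub (integrableOn_mul_pow_mul_one_sub_pow hint m j) i₁, integral_const_mul]
  ring

theorem exists_abs_le_of_continuousOn_of_eq_one {ψ : ℝ → ℝ} {a b : ℝ} (hψ : ContinuousOn ψ (Icc a b))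
    (hone : ∀ t, b ≤ t → ψ t = 1) : ∃ M, 0 ≤ M ∧ ∀ t, a ≤ t → |ψ t| ≤ M := by
  obtain ⟨M, hM⟩ := isCompact_Icc.exists_bound_of_continuousOn hψ
  refine ⟨max M 1, by positivity, fun t ht => ?_⟩
  rcases le_total b t with h | h
  · simp [hone t h]
  · exact (hM t ⟨ht, h⟩).trans (le_max_left _ _)

theorem cutoff_moment_asymptotics {α c : ℝ} (hα : 0 < α) (hc : 1 ≤ c) {ψ : ℝ → ℝ}
    (hψ : ContinuousOn ψ (Ioi 0)) (hzero : ∀ t, 0 < t → t ≤ 2 → ψ t = 0)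
    (hone : ∀ t, 4 ≤ t → ψ t = 1) :
    IntegrableOn (fun x => Real.log (c * ((2 - x) / (2 * x))) ^ (-α) * ψ ((2 - x) / (2 * x)))
      (Ioo 0 1) ∧
    ∀ m : ℕ, (fun j : ℕ => iterDiff (fun i : ℕ => (∫ x in Ioo (0 : ℝ) 1,
        Real.log (c * ((2 - x) / (2 * x))) ^ (-α) * ψ ((2 - x) / (2 * x)) * (1 - x) ^ i)
        - (i : ℝ)⁻¹ * Real.log i ^ (-α)) m j)
      =O[atTop] fun j : ℕ => (j : ℝ) ^ (-1 - (m : ℝ)) * Real.log j ^ (-α - 1) := by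
  obtain ⟨M, hM0, hM⟩ := exists_abs_le_of_continuousOn_of_eq_one (a := 2) (b := 4)
    (hψ.mono fun t ht => lt_of_lt_of_le two_pos ht.1) hone
  have htpos : ∀ x ∈ Ioo (0 : ℝ) 1, 0 < (2 - x) / (2 * x) := fun x hx =>
    div_pos (by linarith [hx.2]) (by linarith [hx.1])
  have hbd : ∀ x ∈ Ioo (0 : ℝ) 1,
      |Real.log (c * ((2 - x) / (2 * x))) ^ (-α) * ψ ((2 - x) / (2 * x))|
        ≤ Real.log 2 ^ (-α) * M := by
    intro x hx
    have hlog2 : 0 < Real.log 2 := Real.log_pos one_lt_two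
    rcases le_total ((2 - x) / (2 * x)) 2 with h | h
    · rw [hzero _ (htpos x hx) h, mul_zero, abs_zero]
      positivity
    · have hlog : Real.log 2 ≤ Real.log (c * ((2 - x) / (2 * x))) :=
        Real.log_le_log two_pos (by nlinarith)
      rw [abs_mul, abs_of_nonneg (Real.rpow_nonneg (hlog2.le.trans hlog) _)]
      exact mul_le_mul (Real.rpow_le_rpow_of_nonpos hlog2 hlog (by linarith)) (hM _ h)
        (abs_nonneg _) (by positivity)
  have hint : IntegrableOn
      (fun x => Real.log (c * ((2 - x) / (2 * x))) ^ (-α) * ψ ((2 - x) / (2 * x))) (Ioo 0 1) := by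
    refine IntegrableOn.of_bound (C := Real.log 2 ^ (-α) * M) (by simp) ?_ ?_
    · refine AEStronglyMeasurable.mul (Measurable.aestronglyMeasurable (by fun_prop)) ?_
      refine ContinuousOn.aestronglyMeasurable (hψ.comp ?_ htpos) measurableSet_Ioo
      exact ContinuousOn.div (by fun_prop) (by fun_prop) fun x hx => by linarith [hx.1]
    · filter_upwards [ae_restrict_mem measurableSet_Ioo] with x hx using hbd x hx
  have hge : ∀ x ∈ Ioo (0 : ℝ) (2 / 9), 4 ≤ (2 - x) / (2 * x) := fun x hx => by
    rw [le_div_iff₀ (by linarith [hx.1])]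
    linarith [hx.2]
  refine ⟨hint, iterDiff_moment_isBigO (C := |Real.log c| + 1) (x₀ := 2 / 9)
    (Λ := fun x => Real.log (c * ((2 - x) / (2 * x)))) hα (by norm_num) hint hbd ?_ ?_ ?_⟩
  · intro x hx
    have := hge x hx
    rw [Real.le_log_iff_exp_le (by positivity)]
    nlinarith [Real.exp_one_lt_d9]
  · intro x hx
    have hx0 := hx.1
    have hx2 := hx.2
    have hy : 8 / 9 ≤ (2 - x) / 2 := by linarith
    have hsplit : Real.log (c * ((2 - x) / (2 * x))) + Real.log x
        = Real.log c + Real.log ((2 - x) / 2) := by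
      rw [← Real.log_mul (mul_ne_zero (by linarith) (by linarith [hge x hx])) hx0.ne',
        ← Real.log_mul (by linarith) (by linarith)]
      congr 1
      field_simp
    have hinv : ((2 - x) / 2)⁻¹ ≤ 2 := by
      rw [inv_le_comm₀ (by linarith) two_pos]
      linarith
    rw [hsplit]
    refine (abs_add_le _ _).trans (add_le_add le_rfl (abs_le.2 ⟨?_, ?_⟩))
    · linarith [Real.one_sub_inv_le_log_of_pos (by linarith : 0 < (2 - x) / 2)]
    · linarith [Real.log_le_sub_one_of_pos (by linarith : 0 < (2 - x) / 2)]
  · intro x hx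
    simp only [hone _ (hge x hx), mul_one]

theorem setIntegral_Ioo_neg_one_one {f : ℝ → ℝ}
    (hr : IntegrableOn (fun x => f (1 - x)) (Ioo 0 1))
    (hl : IntegrableOn (fun x => f (x - 1)) (Ioo 0 1)) :
    ∫ x in Ioo (-1 : ℝ) 1, f x
      = (∫ x in Ioo (0 : ℝ) 1, f (1 - x)) + ∫ x in Ioo (0 : ℝ) 1, f (x - 1) := by
  rw [← intervalIntegrable_iff_integrableOn_Ioo_of_le zero_le_one] at hr hl
  have hr' : IntervalIntegrable f volume 0 1 := by
    simpa using (hr.comp_sub_left 1).symm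
  have hl' : IntervalIntegrable f volume (-1) 0 := by
    simpa using hl.comp_add_right 1
  simp only [← integral_Ioc_eq_integral_Ioo]
  rw [← intervalIntegral.integral_of_le (by norm_num),
    ← intervalIntegral.integral_of_le (by norm_num),
    ← intervalIntegral.integral_of_le (by norm_num),
    ← intervalIntegral.integral_add_adjacent_intervals hl' hr',
    intervalIntegral.integral_comp_sub_left, intervalIntegral.integral_comp_sub_right]
  norm_num [add_comm]

/-- Lemma `lma.e3` of the paper.  The moment sequence
`g_*(j) = ∫_{-1}^1 η_*(μ) μ^j dμ` of
`η_*(μ) = |log((1+μ)/(2(1-μ)))|^{-α}(κ₁ χ_∞((1+μ)/(2(1-μ))) + κ_{-1} χ₀(2(1+μ)/(1-μ)))`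
has the asymptotics
`g_*(j) = (κ₁ + (-1)^j κ_{-1}) j^{-1} (log j)^{-α} + g̃₁(j) + (-1)^j g̃_{-1}(j)` with
`g̃_{±1}^{(m)}(j) = O(j^{-1-m}(log j)^{-α-1})` as `j → ∞` for all `m`. -/
theorem statement14 (α : ℝ) (hα : 0 < α) (κ1 κm1 : ℝ)
    (χ0 χinf : ℝ → ℝ)
    (hχ0sm : ContDiffOn ℝ (⊤ : ℕ∞) χ0 (Set.Ioi 0)) (hχinfsm : ContDiffOn ℝ (⊤ : ℕ∞) χinf (Set.Ioi 0))
    (hχ0one : ∀ t : ℝ, 0 < t → t ≤ 1/4 → χ0 t = 1)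
    (hχ0zero : ∀ t : ℝ, 1/2 ≤ t → χ0 t = 0)
    (hχinfzero : ∀ t : ℝ, 0 < t → t ≤ 2 → χinf t = 0)
    (hχinfone : ∀ t : ℝ, 4 ≤ t → χinf t = 1)
    (ηs : ℝ → ℝ)
    (hηs : ∀ μ : ℝ, -1 < μ → μ < 1 →
      ηs μ = |Real.log ((1 + μ) / (2 * (1 - μ)))| ^ (-α) *
        (κ1 * χinf ((1 + μ) / (2 * (1 - μ))) + κm1 * χ0 (2 * (1 + μ) / (1 - μ))))
    (gs : ℕ → ℝ) (hgs : ∀ j : ℕ, gs j = ∫ μ in Set.Ioo (-1:ℝ) 1, ηs μ * μ ^ j) :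
    ∃ e1 em1 : ℕ → ℝ,
      (∀ j : ℕ, 2 ≤ j →
        gs j = (κ1 + (-1:ℝ)^j * κm1) * (j:ℝ)⁻¹ * Real.log j ^ (-α)
          + e1 j + (-1:ℝ)^j * em1 j) ∧
      (∀ m : ℕ, (fun j : ℕ => iterDiff e1 m j) =O[atTop]
        fun j : ℕ => (j:ℝ) ^ (-1 - (m:ℝ)) * Real.log j ^ (-α - 1)) ∧
      (∀ m : ℕ, (fun j : ℕ => iterDiff em1 m j) =O[atTop]
        fun j : ℕ => (j:ℝ) ^ (-1 - (m:ℝ)) * Real.log j ^ (-α - 1)) := by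
  obtain ⟨hi1, hO1⟩ := cutoff_moment_asymptotics hα le_rfl hχinfsm.continuousOn hχinfzero hχinfone
  obtain ⟨hi2, hO2⟩ := cutoff_moment_asymptotics (c := 4) (ψ := fun t => χ0 t⁻¹) hα (by norm_num)
    (hχ0sm.continuousOn.comp (continuousOn_inv₀.mono fun t ht => (mem_Ioi.1 ht).ne')
      fun t ht => inv_pos.2 (mem_Ioi.1 ht))
    (fun t h0 h2 => hχ0zero _ (by rw [one_div]; gcongr))
    (fun t h4 => hχ0one _ (inv_pos.2 (by linarith)) (by rw [one_div]; gcongr))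
  set u₁ : ℝ → ℝ := fun x => Real.log (1 * ((2 - x) / (2 * x))) ^ (-α) * χinf ((2 - x) / (2 * x))
    with hu₁
  set u₂ : ℝ → ℝ := fun x => Real.log (4 * ((2 - x) / (2 * x))) ^ (-α) * χ0 ((2 - x) / (2 * x))⁻¹
    with hu₂
  have hright : ∀ x ∈ Ioo (0 : ℝ) 1, ηs (1 - x) = κ1 * u₁ x := by
    intro x hx
    have hx0 := hx.1
    have ht : 1 / 2 < (2 - x) / (2 * x) := by
      rw [lt_div_iff₀ (by linarith)]
      linarith [hx.2]
    rw [hηs _ (by linarith [hx.2]) (by linarith),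
      show (1 + (1 - x)) / (2 * (1 - (1 - x))) = (2 - x) / (2 * x) by ring_nf,
      hχ0zero _ (show 1 / 2 ≤ 2 * (1 + (1 - x)) / (1 - (1 - x)) by
        rw [le_div_iff₀ (by linarith)]
        linarith [hx.2])]
    simp only [hu₁, one_mul]
    rcases le_total ((2 - x) / (2 * x)) 2 with h | h
    · simp [hχinfzero _ (by linarith) h]
    · rw [abs_of_nonneg (Real.log_nonneg (by linarith))]
      ring
  have hleft : ∀ x ∈ Ioo (0 : ℝ) 1, ηs (x - 1) = κm1 * u₂ x := by
    intro x hx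
    have hx0 := hx.1
    have h2x : 0 < 2 - x := by linarith [hx.2]
    have ht : 1 / 2 < (2 - x) / (2 * x) := by
      rw [lt_div_iff₀ (by linarith)]
      linarith [hx.2]
    have e : (1 + (x - 1)) / (2 * (1 - (x - 1))) = (4 * ((2 - x) / (2 * x)))⁻¹ := by
      rw [show 1 - (x - 1) = 2 - x by ring]
      field_simp
      ring
    rw [hηs _ (by linarith) (by linarith [hx.2]), e,
      show 2 * (1 + (x - 1)) / (1 - (x - 1)) = ((2 - x) / (2 * x))⁻¹ by
        rw [show 1 - (x - 1) = 2 - x by ring]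
        field_simp
        ring,
      hχinfzero _ (inv_pos.2 (by linarith))
        ((inv_le_one_of_one_le₀ (by linarith)).trans (by norm_num)),
      Real.log_inv, abs_neg, abs_of_nonneg (Real.log_nonneg (by linarith))]
    simp only [hu₂]
    ring
  have hgs' : ∀ j : ℕ, gs j = κ1 * (∫ x in Ioo (0 : ℝ) 1, u₁ x * (1 - x) ^ j)
      + (-1) ^ j * (κm1 * ∫ x in Ioo (0 : ℝ) 1, u₂ x * (1 - x) ^ j) := by
    intro j
    have hr : EqOn (fun x => κ1 * (u₁ x * (1 - x) ^ j)) (fun x => ηs (1 - x) * (1 - x) ^ j)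
        (Ioo 0 1) := fun x hx => by
      simp only [hright x hx]
      ring
    have hl : EqOn (fun x => (-1) ^ j * (κm1 * (u₂ x * (1 - x) ^ j)))
        (fun x => ηs (x - 1) * (x - 1) ^ j) (Ioo 0 1) := fun x hx => by
      simp only [hleft x hx]
      rw [show x - 1 = -1 * (1 - x) by ring, mul_pow]
      ring
    have i₁ := integrableOn_mul_pow_mul_one_sub_pow hi1 0 j
    have i₂ := integrableOn_mul_pow_mul_one_sub_pow hi2 0 j
    simp only [pow_zero, one_mul] at i₁ i₂
    rw [hgs, setIntegral_Ioo_neg_one_one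
      (IntegrableOn.congr_fun (i₁.const_mul κ1) hr measurableSet_Ioo)
      (IntegrableOn.congr_fun ((i₂.const_mul κm1).const_mul ((-1) ^ j)) hl measurableSet_Ioo),
      ← setIntegral_congr_fun measurableSet_Ioo hr, ← setIntegral_congr_fun measurableSet_Ioo hl,
      integral_const_mul, integral_const_mul, integral_const_mul]
  refine ⟨_, _, fun j _ => ?_, fun m => ((hO1 m).const_mul_left κ1).congr_left fun j =>
    (iterDiff_const_mul κ1 _ m j).symm, fun m => ((hO2 m).const_mul_left κm1).congr_left fun j =>
    (iterDiff_const_mul κm1 _ m j).symm⟩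
  rw [hgs']
  ring
end
end
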